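/- arXiv:2206.15029 — 2 statements merged into one kernel-verified Lean document; each statement's English description precedes it below -/
import Mathlib

section
/- Let d ≥ 1, let S = ℂ[x_v : v ∈ {0,1}^d] be the polynomial ring on variables indexed by the vertices of the unit d-cube, let I_{C_d} ⊆ S be the ideal generated by all binomials x_v x_w − x_{v'} x_{w'} with v + w = v' + w' in ℤ^d, and let R_{C_d} = S/I_{C_d}. For 0 ≤ k ≤ d set y_k = ∑_{v ∈ {0,1}^d, v_1+⋯+v_d = k} x_v. Then the images [y_0], [y_1], …, [y_d] in R_{C_d} form a regular sequence: for each 0 ≤ k ≤ d, multiplication by [y_k] is injective on R_{C_d}/([y_0],…,[y_{k−1}]), and R_{C_d}/([y_0],…,[y_d]) ≠ 0. -/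
open MvPolynomial

/-- The toric ideal `I_{C_d}` of the embedding `(ℙ¹)^d ↪ ℙ^{2^d−1}`, inside the polynomial
ring `S = ℂ[x_v : v ∈ {0,1}^d]`: it is generated by the binomials
`x_v x_w − x_{v'} x_{w'}` with `v + w = v' + w'` componentwise in `ℤ^d`. -/
noncomputable def cubeIdeal (d : ℕ) : Ideal (MvPolynomial (Fin d → Fin 2) ℂ) :=
  Ideal.span { p | ∃ v w v' w' : Fin d → Fin 2,
    (∀ i, (v i : ℕ) + (w i : ℕ) = (v' i : ℕ) + (w' i : ℕ)) ∧
    p = X v * X w - X v' * X w' }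

/-- The element `y_k ∈ S`: the sum of all variables `x_v` with coordinate sum
`v₁ + ⋯ + v_d = k`. -/
noncomputable def cubeY (d k : ℕ) : MvPolynomial (Fin d → Fin 2) ℂ :=
  ∑ v ∈ Finset.univ.filter (fun v : Fin d → Fin 2 => ∑ i, (v i : ℕ) = k), X v

/-- For `0 ≤ k ≤ d + 1`, the ideal `I_{C_d} + (y_0, …, y_{k−1})` of `S`. -/
noncomputable def cubeJ (d k : ℕ) : Ideal (MvPolynomial (Fin d → Fin 2) ℂ) :=
  cubeIdeal d ⊔ Ideal.span ((fun j : Fin k => cubeY d j) '' Set.univ)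

namespace CubeReg

/-! ### Combinatorics: vertices, descents, and the weight -/

/-- The tie-broken height of coordinate `i`. -/
def ht {d : ℕ} (m : Fin d → ℕ) (i : Fin d) : ℤ := (d : ℤ) * (m i : ℤ) - (i : ℕ)

/-- The weight. -/
def wt {d : ℕ} (m : Fin d → ℕ) : ℕ := ∑ i, ∑ j, (ht m i - ht m j).natAbs

/-- Integer vector of a vertex. -/
def vv {d : ℕ} (v : Fin d → Fin 2) : Fin d → ℕ := fun i => (v i : ℕ)

/-- `k`-th vertex of the chain of the permutation `π`. -/
def vtx {d : ℕ} (π : Equiv.Perm (Fin d)) (k : ℕ) : Fin d → Fin 2 :=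
  fun i => if (π.symm i : ℕ) < k then 1 else 0

open Classical in
/-- Descent indicator. -/
noncomputable def des {d : ℕ} (π : Equiv.Perm (Fin d)) (k : Fin (d + 1)) : ℕ :=
  if ∃ p q : Fin d, (p : ℕ) + 1 = k ∧ (q : ℕ) = k ∧ π q < π p then 1 else 0

/-- Lattice point attached to `(δ, π)`. -/
def pt {d : ℕ} (π : Equiv.Perm (Fin d)) (δ : Fin (d + 1) → ℕ) : ℕ × (Fin d → ℕ) :=
  ∑ k, δ k • ((1 : ℕ), vv (vtx π k))

lemma ht_injective {d : ℕ} (m : Fin d → ℕ) : Function.Injective (ht m) := by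
  intro i j h
  unfold ht at h
  have h1 : (d : ℤ) * ((m i : ℤ) - m j) = (i : ℕ) - (j : ℕ) := by linarith
  have hi := i.2
  have hj := j.2
  have h2 : ((i : ℕ) : ℤ) - (j : ℕ) = 0 := by
    apply Int.eq_zero_of_abs_lt_dvd (m := d) ⟨_, h1.symm⟩
    rw [abs_lt]; constructor <;> omega
  apply Fin.ext; omega

lemma natAbs_fin2 (a b : Fin 2) :
    (((a : ℕ) : ℤ) - ((b : ℕ) : ℤ)).natAbs + 2 * ((a : ℕ) * (b : ℕ)) = (a : ℕ) + (b : ℕ) := by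
  fin_cases a <;> fin_cases b <;> simp

lemma sum_natAbs {d : ℕ} (v : Fin d → Fin 2) :
    ∑ i, ∑ j, (((v i : ℕ) : ℤ) - ((v j : ℕ) : ℤ)).natAbs + 2 * (∑ i, (v i : ℕ)) ^ 2
      = 2 * d * ∑ i, (v i : ℕ) := by
  have h : ∑ i, ∑ j, ((((v i : ℕ) : ℤ) - ((v j : ℕ) : ℤ)).natAbs + 2 * ((v i : ℕ) * (v j : ℕ)))
      = ∑ i, ∑ j, ((v i : ℕ) + (v j : ℕ)) := by
    simp only [natAbs_fin2]
  simp only [Finset.sum_add_distrib, ← Finset.mul_sum, ← Finset.sum_mul] at h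
  simp at h
  rw [pow_two, h, ← Finset.mul_sum]
  ring

lemma sum_vtx {d : ℕ} (π : Equiv.Perm (Fin d)) (k : ℕ) (hk : k ≤ d) :
    ∑ i, (vtx π k i : ℕ) = k := by
  rw [← Equiv.sum_comp π]
  have : ∀ i : Fin d, (vtx π k (π i) : ℕ) = if (i : ℕ) < k then 1 else 0 := by
    intro i; simp only [vtx, Equiv.symm_apply_apply]; split_ifs <;> rfl
  simp only [this]
  rw [Fin.sum_univ_eq_sum_range (fun i => if i < k then 1 else 0) d]
  simp only [Finset.sum_boole]
  have : (Finset.range d).filter (fun i => i < k) = Finset.range k := by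
    ext i; simp; omega
  rw [this]; simp

/-- The excess weight of adding a vertex of rank `k`. -/
def exc (d k : ℕ) : ℕ := d * (2 * d * k - 2 * k ^ 2)

lemma sum_natAbs_exc {d : ℕ} (v : Fin d → Fin 2) (k : ℕ) (hv : ∑ i, (v i : ℕ) = k) :
    ∑ i, ∑ j, d * (((v i : ℕ) : ℤ) - ((v j : ℕ) : ℤ)).natAbs = exc d k := by
  have := sum_natAbs v
  rw [hv] at this
  simp only [← Finset.mul_sum]
  unfold exc
  congr 1
  omega

lemma ht_add {d : ℕ} (m : Fin d → ℕ) (v : Fin d → Fin 2) (i j : Fin d) :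
    ht (m + vv v) i - ht (m + vv v) j
      = (ht m i - ht m j) + d * (((v i : ℕ) : ℤ) - ((v j : ℕ) : ℤ)) := by
  simp [ht, vv]; ring

lemma term_le {d : ℕ} (m : Fin d → ℕ) (v : Fin d → Fin 2) (i j : Fin d) :
    (ht (m + vv v) i - ht (m + vv v) j).natAbs ≤
      (ht m i - ht m j).natAbs + d * (((v i : ℕ) : ℤ) - ((v j : ℕ) : ℤ)).natAbs := by
  rw [ht_add]
  refine (Int.natAbs_add_le _ _).trans ?_
  rw [Int.natAbs_mul]; simp

lemma wt_add_le {d : ℕ} (m : Fin d → ℕ) (v : Fin d → Fin 2) (k : ℕ)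
    (hv : ∑ i, (v i : ℕ) = k) : wt (m + vv v) ≤ wt m + exc d k := by
  rw [← sum_natAbs_exc v k hv, wt, wt, ← Finset.sum_add_distrib]
  simp only [← Finset.sum_add_distrib]
  exact Finset.sum_le_sum fun i _ => Finset.sum_le_sum fun j _ => term_le m v i j

lemma wt_add_vtx {d : ℕ} (m : Fin d → ℕ) (π : Equiv.Perm (Fin d))
    (hm : StrictAnti (ht m ∘ π)) (k : ℕ) (hk : k ≤ d) :
    wt (m + vv (vtx π k)) = wt m + exc d k := by
  rw [← sum_natAbs_exc (vtx π k) k (sum_vtx π k hk), wt, wt, ← Finset.sum_add_distrib]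
  simp only [← Finset.sum_add_distrib]
  refine Finset.sum_congr rfl fun i _ => Finset.sum_congr rfl fun j _ => ?_
  rw [ht_add]
  obtain ⟨p, rfl⟩ := π.surjective i
  obtain ⟨q, rfl⟩ := π.surjective j
  simp only [vtx, Equiv.symm_apply_apply]
  have h1 : p < q → ht m (π q) < ht m (π p) := fun h => hm h
  have h2 : q < p → ht m (π p) < ht m (π q) := fun h => hm h
  rw [Fin.lt_def] at h1 h2
  split_ifs <;> simp <;> omega

lemma wt_add_lt {d : ℕ} (m : Fin d → ℕ) (π : Equiv.Perm (Fin d))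
    (hm : StrictAnti (ht m ∘ π)) (k : ℕ) (hk : k ≤ d) (v : Fin d → Fin 2)
    (hv : ∑ i, (v i : ℕ) = k) (hne : v ≠ vtx π k) :
    wt (m + vv v) < wt m + exc d k := by
  have hs := sum_vtx π k hk
  -- find the two witnesses
  have hi : ∃ i, (vtx π k i : ℕ) < (v i : ℕ) := by
    by_contra! h
    apply hne
    funext i
    have := (Finset.sum_eq_sum_iff_of_le (fun i _ => h i)).1 (hv.trans hs.symm) i (Finset.mem_univ i)
    exact Fin.ext this
  have hj : ∃ j, (v j : ℕ) < (vtx π k j : ℕ) := by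
    by_contra! h
    apply hne
    funext i
    have := (Finset.sum_eq_sum_iff_of_le (fun i _ => h i)).1 (hs.trans hv.symm) i (Finset.mem_univ i)
    exact Fin.ext this.symm
  obtain ⟨i, hi⟩ := hi
  obtain ⟨j, hj⟩ := hj
  rw [← sum_natAbs_exc v k hv, wt, wt, ← Finset.sum_add_distrib]
  simp only [← Finset.sum_add_distrib]
  refine Finset.sum_lt_sum (fun i _ => Finset.sum_le_sum fun j _ => term_le m v i j)
    ⟨i, Finset.mem_univ _, Finset.sum_lt_sum (fun j _ => term_le m v i j)
      ⟨j, Finset.mem_univ _, ?_⟩⟩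
  rw [ht_add]
  have hvi : (v i : ℕ) = 1 := by have := (v i).2; omega
  have hvj : (v j : ℕ) = 0 := by have := (vtx π k j).2; omega
  have hd : 0 < d := i.pos
  obtain ⟨p, rfl⟩ := π.surjective i
  obtain ⟨q, rfl⟩ := π.surjective j
  simp only [vtx, Equiv.symm_apply_apply] at hi hj
  have hp : ¬ (p : ℕ) < k := by
    intro h; simp [h] at hi; omega
  have hq : (q : ℕ) < k := by
    by_contra h; simp [h] at hj
  have hqp : q < p := by rw [Fin.lt_def]; omega
  have h2 : ht m (π p) < ht m (π q) := hm hqp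
  rw [hvi, hvj]
  simp
  omega

lemma pt_fst {d : ℕ} (π : Equiv.Perm (Fin d)) (δ : Fin (d + 1) → ℕ) :
    (pt π δ).1 = ∑ k, δ k := by
  simp [pt, Prod.fst_sum]

lemma pt_snd {d : ℕ} (π : Equiv.Perm (Fin d)) (δ : Fin (d + 1) → ℕ) (p : Fin d) :
    (pt π δ).2 (π p) = ∑ k : Fin (d + 1), if (p : ℕ) < k then δ k else 0 := by
  simp only [pt, Prod.snd_sum, Finset.sum_apply, Prod.smul_snd, Pi.smul_apply, vv, vtx,
    Equiv.symm_apply_apply]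
  refine Finset.sum_congr rfl fun k _ => ?_
  split_ifs <;> simp

lemma pt_snd_succ {d : ℕ} (π : Equiv.Perm (Fin d)) (δ : Fin (d + 1) → ℕ) (p q : Fin d)
    (k : Fin (d + 1)) (hp : (p : ℕ) + 1 = k) (hq : (q : ℕ) = k) :
    (pt π δ).2 (π p) = (pt π δ).2 (π q) + δ k := by
  rw [pt_snd, pt_snd]
  have : δ k = ∑ l : Fin (d + 1), if l = k then δ l else 0 := by simp
  rw [this, ← Finset.sum_add_distrib]
  refine Finset.sum_congr rfl fun l _ => ?_
  rcases lt_trichotomy (l : ℕ) k with h | h | h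
  · rw [if_neg (by omega), if_neg (by omega), if_neg (by intro h'; rw [h'] at h; omega)]
  · rw [if_pos (by omega), if_neg (by omega), if_pos (Fin.ext h)]; simp
  · rw [if_pos (by omega), if_pos (by omega), if_neg (by intro h'; rw [h'] at h; omega)]; simp

lemma pt_le {d : ℕ} (π : Equiv.Perm (Fin d)) (δ : Fin (d + 1) → ℕ) (i : Fin d) :
    (pt π δ).2 i ≤ (pt π δ).1 := by
  obtain ⟨p, rfl⟩ := π.surjective i
  rw [pt_snd, pt_fst]
  refine Finset.sum_le_sum fun k _ => ?_
  split_ifs <;> simp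

lemma pt_strictAnti {d : ℕ} (π : Equiv.Perm (Fin d)) (α : Fin (d + 1) → ℕ) :
    StrictAnti (ht (pt π (α + des π)).2 ∘ π) := by
  cases d with
  | zero => exact fun a => a.elim0
  | succ e =>
    rw [Fin.strictAnti_iff_succ_lt]
    intro i
    have h := pt_snd_succ π (α + des π) i.castSucc i.succ i.succ.castSucc (by simp) (by simp)
    simp only [Function.comp, ht, h, Pi.add_apply, des]
    have h1 := (π i.castSucc).2
    have h2 := (π i.succ).2
    have hne : π i.succ ≠ π i.castSucc := by
      intro h; exact absurd (π.injective h) (by simp [Fin.ext_iff])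
    rw [Ne, Fin.ext_iff] at hne
    push_cast
    have hα : 0 ≤ ((e : ℤ) + 1) * (α i.succ.castSucc : ℤ) := by positivity
    split_ifs with hc
    · push_cast; nlinarith
    · have : ¬ π i.succ < π i.castSucc := fun h' => hc ⟨i.castSucc, i.succ, by simp, by simp, h'⟩
      rw [Fin.lt_def] at this
      have h3 : ((π i.castSucc : ℕ) : ℤ) < ((π i.succ : ℕ) : ℤ) := by omega
      push_cast; nlinarith

lemma perm_unique {d : ℕ} (f : Fin d → ℤ) (π σ : Equiv.Perm (Fin d))
    (h1 : StrictAnti (f ∘ π)) (h2 : StrictAnti (f ∘ σ)) : π = σ := by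
  have hr : Set.range (fun i => - (f ∘ π) i) = Set.range (fun i => - (f ∘ σ) i) := by
    ext x; constructor
    · rintro ⟨i, rfl⟩; exact ⟨σ.symm (π i), by simp⟩
    · rintro ⟨i, rfl⟩; exact ⟨π.symm (σ i), by simp⟩
  have hm1 : StrictMono (fun i => - (f ∘ π) i) := h1.neg
  have hm2 : StrictMono (fun i => - (f ∘ σ) i) := h2.neg
  have := (StrictMono.range_inj hm1 hm2).1 hr
  have hf : Function.Injective f := by
    have := h1.injective
    intro a b hab
    have := @this (π.symm a) (π.symm b) (by simpa using hab)
    simpa using this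
  ext i : 1
  have := congrFun this i
  apply hf
  simpa using this

lemma pt_injective {d : ℕ} (π σ : Equiv.Perm (Fin d)) (α β : Fin (d + 1) → ℕ)
    (h : pt π (α + des π) = pt σ (β + des σ)) : π = σ ∧ α = β := by
  have h1 := pt_strictAnti π α
  have h2 := pt_strictAnti σ β
  rw [h] at h1
  obtain rfl := perm_unique _ _ _ h1 h2
  refine ⟨rfl, ?_⟩
  suffices hs : α + des π = β + des π from add_right_cancel hs
  set δ := α + des π
  set ε := β + des π
  -- partial sums agree
  have key : ∀ p : ℕ, p ≤ d + 1 → ∑ k : Fin (d + 1), (if p ≤ (k : ℕ) then δ k else 0)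
      = ∑ k : Fin (d + 1), (if p ≤ (k : ℕ) then ε k else 0) := by
    intro p hp
    rcases p with _ | p
    · have := congrArg Prod.fst h
      rw [pt_fst, pt_fst] at this
      simpa using this
    · rcases Nat.lt_or_ge p d with hpd | hpd
      · have := congrFun (congrArg Prod.snd h) (π ⟨p, hpd⟩)
        rw [pt_snd, pt_snd] at this
        simpa [Nat.succ_le_iff] using this
      · refine Finset.sum_congr rfl fun k _ => ?_
        rw [if_neg (by omega), if_neg (by omega)]
  funext k
  have split : ∀ γ : Fin (d + 1) → ℕ, ∑ l : Fin (d + 1), (if (k : ℕ) ≤ (l : ℕ) then γ l else 0)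
      = ∑ l : Fin (d + 1), (if (k : ℕ) + 1 ≤ (l : ℕ) then γ l else 0) + γ k := by
    intro γ
    have : γ k = ∑ l : Fin (d + 1), if l = k then γ l else 0 := by simp
    rw [this, ← Finset.sum_add_distrib]
    refine Finset.sum_congr rfl fun l _ => ?_
    rcases lt_trichotomy (l : ℕ) k with h | h | h
    · rw [if_neg (by omega), if_neg (by omega), if_neg (by intro h'; rw [h'] at h; omega)]
    · rw [if_pos (by omega), if_neg (by omega), if_pos (Fin.ext h)]; simp
    · rw [if_pos (by omega), if_pos (by omega), if_neg (by intro h'; rw [h'] at h; omega)]; simp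
  have k1 := key k (by omega)
  have k2 := key (k + 1) (by omega)
  rw [split δ, split ε, k2] at k1
  omega

lemma telescope (E : ℕ → ℕ) (hE : Antitone E) (p N : ℕ) (h : p ≤ N) :
    ∑ k ∈ Finset.range N, (if p ≤ k then E k - E (k + 1) else 0) = E p - E N := by
  induction N, h using Nat.le_induction with
  | base =>
    rw [Nat.sub_self]
    refine Finset.sum_eq_zero fun k hk => ?_
    rw [if_neg]; simpa using hk
  | succ N hN ih =>
    rw [Finset.sum_range_succ, ih, if_pos hN]
    have := hE hN
    have := hE (Nat.le_succ N)
    simp only [Nat.succ_eq_add_one] at this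
    omega

lemma pt_surjective {d : ℕ} (n : ℕ) (m : Fin d → ℕ) (hm : ∀ i, m i ≤ n) :
    ∃ (π : Equiv.Perm (Fin d)) (α : Fin (d + 1) → ℕ), pt π (α + des π) = (n, m) := by
  obtain ⟨π, hπ⟩ : ∃ π : Equiv.Perm (Fin d), StrictAnti (ht m ∘ π) := by
    refine ⟨Tuple.sort (fun i => - ht m i), ?_⟩
    have h1 := Tuple.monotone_sort (fun i => - ht m i)
    intro a b hab
    have h2 := h1 hab.le
    simp only [Function.comp] at h2 ⊢
    refine lt_of_le_of_ne (by linarith) ?_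
    intro h
    have := (Tuple.sort (fun i => - ht m i)).injective (ht_injective m h)
    exact absurd this hab.ne'
  have hle : ∀ p q : Fin d, p ≤ q → m (π q) ≤ m (π p) := by
    intro p q hpq
    rcases hpq.eq_or_lt with rfl | hlt
    · exact le_rfl
    have h : ht m (π q) < ht m (π p) := hπ hlt
    unfold ht at h
    by_contra! hc
    have h1 := (π q).2
    have h3 : ((m (π p) : ℤ) + 1) ≤ m (π q) := by exact_mod_cast hc
    have h4 : (d : ℤ) * (m (π p) + 1) ≤ d * m (π q) := by gcongr
    have h5 : ((π q : ℕ) : ℤ) < d := by exact_mod_cast h1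
    have h6 : (0 : ℤ) ≤ ((π p : ℕ) : ℤ) := by positivity
    linarith
  let E : ℕ → ℕ := fun k => if k = 0 then n else if h : k - 1 < d then m (π ⟨k - 1, h⟩) else 0
  have hE : Antitone E := by
    intro a b hab
    simp only [E]
    split_ifs with h1 h2 h3 h4 h5 h6 h7
    all_goals first
      | exact le_rfl
      | exact hm _
      | exact Nat.zero_le _
      | omega
      | (apply hle; rw [Fin.le_def]; simp; omega)
  have hlast : E (d + 1) = 0 := by simp [E]
  let δ : Fin (d + 1) → ℕ := fun k => E k - E (k + 1)
  have hδ : ∀ k, des π k ≤ δ k := by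
    intro k
    unfold des
    split_ifs with hc
    · obtain ⟨p, q, hp, hq, hlt⟩ := hc
      have hE1 : E k = m (π p) := by
        have : (k : ℕ) ≠ 0 := by omega
        have h' : (k : ℕ) - 1 < d := by omega
        have h'' : (⟨(k : ℕ) - 1, h'⟩ : Fin d) = p := by apply Fin.ext; simp; omega
        simp [E, this, h', h'']
      have hE2 : E (k + 1) = m (π q) := by
        have h' : (k : ℕ) < d := by omega
        have h'' : (⟨(k : ℕ), h'⟩ : Fin d) = q := by apply Fin.ext; simp; omega
        simp [E, h', h'']
      have hpq : p < q := by rw [Fin.lt_def]; omega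
      have h : ht m (π q) < ht m (π p) := hπ hpq
      have hl := hle p q hpq.le
      simp only [δ, hE1, hE2]
      unfold ht at h
      by_contra! hc
      have : m (π p) = m (π q) := by omega
      rw [this] at h
      rw [Fin.lt_def] at hlt
      omega
    · exact Nat.zero_le _
  refine ⟨π, δ - des π, ?_⟩
  have : δ - des π + des π = δ := tsub_add_cancel_of_le hδ
  rw [this]
  have tele : ∀ p, p ≤ d + 1 → ∑ k : Fin (d + 1), (if p ≤ (k : ℕ) then δ k else 0) = E p := by
    intro p hp
    rw [Fin.sum_univ_eq_sum_range (fun k => if p ≤ k then E k - E (k + 1) else 0) (d + 1),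
      telescope E hE p (d + 1) hp, hlast, Nat.sub_zero]
  refine Prod.ext ?_ ?_
  · rw [pt_fst]
    have := tele 0 (by omega)
    simpa [E] using this
  · funext i
    obtain ⟨p, rfl⟩ := π.surjective i
    rw [pt_snd]
    have := tele (p + 1) (by omega)
    simpa [E, Nat.succ_le_iff] using this

lemma pt_add_single {d : ℕ} (π : Equiv.Perm (Fin d)) (δ : Fin (d + 1) → ℕ) (k : Fin (d + 1)) :
    pt π (δ + Pi.single k 1) = pt π δ + (1, vv (vtx π k)) := by
  unfold pt
  simp only [Pi.add_apply, add_smul, Finset.sum_add_distrib]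
  congr 1
  rw [Finset.sum_eq_single k]
  · simp
  · intro b _ hb; simp [Pi.single_eq_of_ne hb]
  · simp

/-! ### The toric map and its kernel -/

/-- The toric map to the monoid algebra. -/
noncomputable def phi (d : ℕ) :
    MvPolynomial (Fin d → Fin 2) ℂ →ₐ[ℂ] AddMonoidAlgebra ℂ (ℕ × (Fin d → ℕ)) :=
  aeval (fun v => AddMonoidAlgebra.single (1, vv v) 1)

lemma phi_X {d : ℕ} (v : Fin d → Fin 2) :
    phi d (X v) = AddMonoidAlgebra.single (1, vv v) 1 := by simp [phi]

/-- product of variables along a list -/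
noncomputable def lp {d : ℕ} (l : List (Fin d → Fin 2)) : MvPolynomial (Fin d → Fin 2) ℂ :=
  (l.map X).prod

/-- exponent sum along a list -/
def ls {d : ℕ} (l : List (Fin d → Fin 2)) : ℕ × (Fin d → ℕ) :=
  (l.map (fun v => ((1 : ℕ), vv v))).sum

lemma phi_lp {d : ℕ} (l : List (Fin d → Fin 2)) :
    phi d (lp l) = AddMonoidAlgebra.single (ls l) 1 := by
  induction l with
  | nil => simp only [lp, ls, List.map_nil, List.prod_nil, List.sum_nil, map_one]; rfl
  | cons v l ih =>
    have : lp (v :: l) = X v * lp l := by simp [lp]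
    rw [this, map_mul, ih, phi_X, AddMonoidAlgebra.single_mul_single]
    simp [ls]

lemma ls_fst {d : ℕ} (l : List (Fin d → Fin 2)) : (ls l).1 = l.length := by
  induction l with
  | nil => simp [ls]
  | cons v l ih =>
    have : ls (v :: l) = (1, vv v) + ls l := by simp [ls]
    rw [this]; simp [ih]; omega

lemma fin2_supinf (a b : Fin 2) : (a : ℕ) + (b : ℕ) = ((a ⊔ b : Fin 2) : ℕ) + ((a ⊓ b : Fin 2) : ℕ) := by
  revert a b; decide

lemma fin2_sup_zero (a b : Fin 2) : ((a ⊔ b : Fin 2) : ℕ) = 0 ↔ (a : ℕ) = 0 ∧ (b : ℕ) = 0 := by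
  revert a b; decide

lemma pull_top {d : ℕ} (l : List (Fin d → Fin 2)) : ∀ u : Fin d → Fin 2,
    ∃ (t : Fin d → Fin 2) (l' : List (Fin d → Fin 2)),
      l'.length = l.length ∧
      ls (u :: l) = ls (t :: l') ∧
      (∀ i, (t i : ℕ) = 0 ↔ (ls (u :: l)).2 i = 0) ∧
      lp (u :: l) - lp (t :: l') ∈ cubeIdeal d := by
  induction l with
  | nil =>
    intro u
    exact ⟨u, [], rfl, rfl, fun i => by simp [ls, vv], by simp⟩
  | cons w l ih =>
    intro u
    obtain ⟨t, l', h1, h2, h3, h4⟩ := ih (u ⊔ w)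
    have hc : ∀ (v : Fin d → Fin 2) (s : List (Fin d → Fin 2)), ls (v :: s) = (1, vv v) + ls s := by
      intro v s; simp [ls]
    have hcp : ∀ (v : Fin d → Fin 2) (s : List (Fin d → Fin 2)), lp (v :: s) = X v * lp s := by
      intro v s; simp [lp]
    have hvv : vv u + vv w = vv (u ⊔ w) + vv (u ⊓ w) := by
      funext i; exact fin2_supinf (u i) (w i)
    refine ⟨t, (u ⊓ w) :: l', by simp [h1], ?_, ?_, ?_⟩
    · rw [hc, hc] at h2
      rw [hc, hc, hc, hc]
      calc ((1 : ℕ), vv u) + ((1, vv w) + ls l) = (2, vv u + vv w) + ls l := by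
            rw [← add_assoc]; rfl
        _ = (1, vv (u ⊓ w)) + ((1, vv (u ⊔ w)) + ls l) := by
            rw [hvv, ← add_assoc, add_comm (vv (u ⊔ w))]; rfl
        _ = _ := by rw [h2]; abel
    · intro i
      rw [h3 i, hc, hc, hc]
      have := fin2_sup_zero (u i) (w i)
      simp only [Prod.snd_add, Pi.add_apply, vv, Pi.sup_apply, add_eq_zero]
      tauto
    · have hrel : (X u * X w - X (u ⊔ w) * X (u ⊓ w) : MvPolynomial (Fin d → Fin 2) ℂ)
          ∈ cubeIdeal d := by
        apply Ideal.subset_span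
        exact ⟨u, w, u ⊔ w, u ⊓ w, fun i => fin2_supinf (u i) (w i), rfl⟩
      have : lp (u :: w :: l) - lp (t :: (u ⊓ w) :: l')
          = lp l * (X u * X w - X (u ⊔ w) * X (u ⊓ w))
            + X (u ⊓ w) * (lp ((u ⊔ w) :: l) - lp (t :: l')) := by
        simp only [hcp]; ring
      rw [this]
      exact Ideal.add_mem _ (Ideal.mul_mem_left _ _ hrel) (Ideal.mul_mem_left _ _ h4)

lemma lp_congr {d : ℕ} (n : ℕ) : ∀ (l l' : List (Fin d → Fin 2)), l.length = n →
    ls l = ls l' → lp l - lp l' ∈ cubeIdeal d := by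
  induction n with
  | zero =>
    intro l l' hl h
    have h' : l'.length = 0 := by rw [← ls_fst, ← h, ls_fst, hl]
    rw [List.length_eq_zero_iff] at hl h'
    simp [hl, h']
  | succ n ih =>
    intro l l' hl h
    have h' : l'.length = n + 1 := by rw [← ls_fst, ← h, ls_fst, hl]
    obtain ⟨u, s, rfl⟩ := List.exists_cons_of_length_eq_add_one hl
    obtain ⟨u', s', rfl⟩ := List.exists_cons_of_length_eq_add_one h'
    obtain ⟨t, r, a1, a2, a3, a4⟩ := pull_top s u
    obtain ⟨t', r', b1, b2, b3, b4⟩ := pull_top s' u'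
    have ht : t = t' := by
      funext i
      have h3 := a3 i
      rw [h, ← b3 i] at h3
      apply Fin.ext
      have := (t i).2
      have := (t' i).2
      omega
    subst ht
    have hcp : ∀ (v : Fin d → Fin 2) (s : List (Fin d → Fin 2)), lp (v :: s) = X v * lp s := by
      intro v s; simp [lp]
    have hr : ls r = ls r' := by
      have : ls (t :: r) = ls (t :: r') := by rw [← a2, ← b2, h]
      simpa [ls] using this
    have := ih r r' (by simp at hl; omega) hr
    have e : lp (u :: s) - lp (u' :: s') = (lp (u :: s) - lp (t :: r))
        + X t * (lp r - lp r') - (lp (u' :: s') - lp (t :: r')) := by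
      simp only [hcp]; ring
    rw [e]
    exact Ideal.sub_mem _ (Ideal.add_mem _ a4 (Ideal.mul_mem_left _ _ this)) b4

lemma monomial_eq_lp {d : ℕ} (s : (Fin d → Fin 2) →₀ ℕ) :
    ∃ l : List (Fin d → Fin 2), (monomial s (1 : ℂ)) = lp l := by
  refine ⟨s.toMultiset.toList, ?_⟩
  unfold lp
  rw [← Multiset.prod_coe, ← Multiset.map_coe, Multiset.coe_toList]
  induction s using Finsupp.induction_linear with
  | zero => simp
  | add f g hf hg => 
    rw [map_add, Multiset.map_add, Multiset.prod_add, ← hf, ← hg, monomial_mul, one_mul]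
  | single a n =>
    rw [Finsupp.toMultiset_single, Multiset.map_nsmul, Multiset.prod_nsmul]
    simp [X_pow_eq_monomial]

lemma phi_cubeIdeal {d : ℕ} {f : MvPolynomial (Fin d → Fin 2) ℂ} (hf : f ∈ cubeIdeal d) :
    phi d f = 0 := by
  have : cubeIdeal d ≤ RingHom.ker (phi d) := by
    apply Ideal.span_le.2
    rintro p ⟨v, w, v', w', h, rfl⟩
    have hvv : vv v + vv w = vv v' + vv w' := funext h
    simp only [SetLike.mem_coe, RingHom.mem_ker, map_sub, map_mul, phi_X,
      AddMonoidAlgebra.single_mul_single, Prod.mk_add_mk, hvv, sub_self]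
  exact this hf

open Classical in
lemma mem_cubeIdeal_of_phi {d : ℕ} {f : MvPolynomial (Fin d → Fin 2) ℂ} (hf : phi d f = 0) :
    f ∈ cubeIdeal d := by
  let c : ℕ × (Fin d → ℕ) → MvPolynomial (Fin d → Fin 2) ℂ ⧸ cubeIdeal d := fun g =>
    if h : ∃ l, ls l = g then Ideal.Quotient.mk _ (lp h.choose) else 0
  let ψ : AddMonoidAlgebra ℂ (ℕ × (Fin d → ℕ)) →ₗ[ℂ] MvPolynomial (Fin d → Fin 2) ℂ ⧸ cubeIdeal d :=
    (Finsupp.linearCombination ℂ c) ∘ₗ (AddMonoidAlgebra.coeffLinearEquiv ℂ).toLinearMap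
  have hψ : ψ ∘ₗ (phi d).toLinearMap = (Ideal.Quotient.mkₐ ℂ (cubeIdeal d)).toLinearMap := by
    apply (basisMonomials _ ℂ).ext
    intro s
    obtain ⟨l, hl⟩ := monomial_eq_lp s
    simp only [coe_basisMonomials, hl, LinearMap.comp_apply, AlgHom.toLinearMap_apply, phi_lp]
    have he : ∃ l', ls l' = ls l := ⟨l, rfl⟩
    have : ψ (AddMonoidAlgebra.single (ls l) 1) = c (ls l) := by simp [ψ]
    rw [this]
    simp only [c, dif_pos he]
    rw [Ideal.Quotient.mkₐ_eq_mk, Ideal.Quotient.mk_eq_mk_iff_sub_mem]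
    exact lp_congr _ _ _ rfl he.choose_spec
  have h := LinearMap.congr_fun hψ f
  simp only [LinearMap.comp_apply, AlgHom.toLinearMap_apply, hf, map_zero] at h
  exact Ideal.Quotient.eq_zero_iff_mem.1 h.symm

/-! ### The basis -/

/-- Lattice points of the cone over the cube with weight below `w`, spanned. -/
noncomputable def low (d w : ℕ) : Submodule ℂ (AddMonoidAlgebra ℂ (ℕ × (Fin d → ℕ))) :=
  Submodule.span ℂ {x | ∃ g : ℕ × (Fin d → ℕ), (∀ i, g.2 i ≤ g.1) ∧ wt g.2 < w ∧
    x = AddMonoidAlgebra.single g 1}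

/-- The candidate basis. -/
noncomputable def bas {d : ℕ} (i : (Fin (d + 1) → ℕ) × Equiv.Perm (Fin d)) :
    MvPolynomial (Fin d → Fin 2) ℂ :=
  (∏ k : Fin (d + 1), cubeY d k ^ i.1 k) * ∏ k : Fin (d + 1), X (vtx i.2 k) ^ des i.2 k

/-- leading exponent -/
noncomputable def lead {d : ℕ} (i : (Fin (d + 1) → ℕ) × Equiv.Perm (Fin d)) : ℕ × (Fin d → ℕ) :=
  pt i.2 (i.1 + des i.2)

lemma cubeY_mul_bas {d : ℕ} (α : Fin (d + 1) → ℕ) (π : Equiv.Perm (Fin d)) (k : Fin (d + 1)) :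
    cubeY d k * bas (α, π) = bas (α + Pi.single k 1, π) := by
  unfold bas
  simp only [Pi.add_apply, pow_add, Finset.prod_mul_distrib]
  have : ∏ l : Fin (d + 1), cubeY d l ^ (Pi.single k 1 : Fin (d + 1) → ℕ) l = cubeY d k := by
    rw [Finset.prod_eq_single k]
    · simp
    · intro b _ hb; simp [Pi.single_eq_of_ne hb]
    · simp
  rw [this]; ring

lemma vv_le {d : ℕ} (v : Fin d → Fin 2) (i : Fin d) : vv v i ≤ 1 := by
  have := (v i).2
  unfold vv; omega

lemma phi_cubeY {d : ℕ} (k : ℕ) : phi d (cubeY d k) =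
    ∑ v ∈ Finset.univ.filter (fun v : Fin d → Fin 2 => ∑ i, (v i : ℕ) = k),
      AddMonoidAlgebra.single (1, vv v) 1 := by
  simp [cubeY, phi_X]

lemma cubeY_mul_low {d : ℕ} (k w : ℕ) {x : AddMonoidAlgebra ℂ (ℕ × (Fin d → ℕ))}
    (hx : x ∈ low d w) : phi d (cubeY d k) * x ∈ low d (w + exc d k) := by
  unfold low at hx
  induction hx using Submodule.span_induction with
  | mem x h =>
    obtain ⟨g, h1, h2, rfl⟩ := h
    rw [phi_cubeY, Finset.sum_mul]
    refine Submodule.sum_mem _ fun v hv => ?_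
    rw [AddMonoidAlgebra.single_mul_single, one_mul, add_comm (1, vv v)]
    refine Submodule.subset_span ⟨_, fun i => ?_, ?_, rfl⟩
    · exact add_le_add (h1 i) (vv_le v i)
    · have := wt_add_le g.2 v k (by simpa using hv)
      exact lt_of_le_of_lt this (by omega)
  | zero => simp
  | add x y _ _ hx hy => rw [mul_add]; exact Submodule.add_mem _ hx hy
  | smul a x _ hx => rw [mul_smul_comm]; exact Submodule.smul_mem _ _ hx

lemma phi_bas {d : ℕ} (π : Equiv.Perm (Fin d)) (N : ℕ) : ∀ α : Fin (d + 1) → ℕ, ∑ k, α k = N →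
    phi d (bas (α, π)) - AddMonoidAlgebra.single (lead (α, π)) 1 ∈ low d (wt (lead (α, π)).2) := by
  induction N with
  | zero =>
    intro α hα
    have : α = 0 := by
      funext k
      exact (Finset.sum_eq_zero_iff.1 hα) k (Finset.mem_univ k)
    subst this
    have : phi d (bas (0, π)) = AddMonoidAlgebra.single (lead (0, π)) 1 := by
      unfold bas lead pt
      simp only [Pi.zero_apply, pow_zero, Finset.prod_const_one, one_mul, map_prod, map_pow, phi_X,
        AddMonoidAlgebra.single_pow, one_pow, zero_add]
      generalize (Finset.univ : Finset (Fin (d + 1))) = s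
      induction s using Finset.induction_on with
      | empty => simp only [Finset.prod_empty, Finset.sum_empty]; rfl
      | insert a s ha ih =>
        rw [Finset.prod_insert ha, Finset.sum_insert ha, ih, AddMonoidAlgebra.single_mul_single,
          one_mul]
    rw [this, sub_self]
    exact Submodule.zero_mem _
  | succ N ih =>
    intro α hα
    obtain ⟨k, hk⟩ : ∃ k, 0 < α k := by
      by_contra! h
      have : ∑ k, α k = 0 := Finset.sum_eq_zero fun k _ => by have := h k; omega
      omega
    obtain ⟨β, rfl⟩ : ∃ β : Fin (d + 1) → ℕ, α = β + Pi.single k 1 := by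
      refine ⟨α - Pi.single k 1, (tsub_add_cancel_of_le ?_).symm⟩
      intro l
      by_cases h : l = k
      · subst h; simp; omega
      · simp [Pi.single_eq_of_ne h]
    have hβ : ∑ k, β k = N := by
      simp [Finset.sum_add_distrib] at hα
      exact hα
    have h1 := cubeY_mul_low k _ (ih β hβ)
    have hlead : lead (β + Pi.single k 1, π) = lead (β, π) + (1, vv (vtx π k)) := by
      unfold lead
      rw [← pt_add_single]
      simp only
      congr 1
      abel
    have hk' : (k : ℕ) ≤ d := by omega
    have hwt : wt (lead (β + Pi.single k 1, π)).2 = wt (lead (β, π)).2 + exc d k := by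
      rw [hlead, Prod.snd_add]
      exact wt_add_vtx _ π (pt_strictAnti π β) k hk'
    rw [hwt, ← cubeY_mul_bas, map_mul]
    have h2 : phi d (cubeY d k) * AddMonoidAlgebra.single (lead (β, π)) 1
        - AddMonoidAlgebra.single (lead (β + Pi.single k 1, π)) 1
        ∈ low d (wt (lead (β, π)).2 + exc d k) := by
      have hmem : vtx π k ∈ Finset.univ.filter
          (fun v : Fin d → Fin 2 => ∑ i, (v i : ℕ) = k) := by
        simp [sum_vtx π k hk']
      rw [phi_cubeY, Finset.sum_mul, ← Finset.add_sum_erase _ _ hmem,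
        AddMonoidAlgebra.single_mul_single, one_mul, hlead, add_comm (1, vv (vtx π k)),
        add_sub_cancel_left]
      refine Submodule.sum_mem _ fun v hv => ?_
      rw [AddMonoidAlgebra.single_mul_single, one_mul, add_comm (1, vv v)]
      rw [Finset.mem_erase, Finset.mem_filter] at hv
      refine Submodule.subset_span ⟨_, fun i => ?_, ?_, rfl⟩
      · exact add_le_add (pt_le _ _ i) (vv_le v i)
      · exact wt_add_lt _ π (pt_strictAnti π β) k hk' v hv.2.2 hv.1
    have := Submodule.add_mem _ h1 h2
    rwa [mul_sub, sub_add_sub_cancel] at this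

lemma low_coeff {d w : ℕ} {x : AddMonoidAlgebra ℂ (ℕ × (Fin d → ℕ))} (hx : x ∈ low d w)
    (g : ℕ × (Fin d → ℕ)) (hg : w ≤ wt g.2) : x.coeff g = 0 := by
  unfold low at hx
  induction hx using Submodule.span_induction with
  | mem x h =>
    obtain ⟨g', h1, h2, rfl⟩ := h
    rw [AddMonoidAlgebra.coeff_single, Finsupp.single_eq_of_ne]
    rintro rfl
    omega
  | zero => simp
  | add x y _ _ hx hy => simp [hx, hy]
  | smul a x _ hx => simp [hx]

lemma lead_injective {d : ℕ} : Function.Injective (lead (d := d)) := by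
  rintro ⟨α, π⟩ ⟨β, σ⟩ h
  obtain ⟨h1, h2⟩ := pt_injective π σ α β h
  rw [h1, h2]

lemma bas_coeff {d : ℕ} (i j : (Fin (d + 1) → ℕ) × Equiv.Perm (Fin d))
    (h : wt (lead j).2 ≤ wt (lead i).2) :
    (phi d (bas j)).coeff (lead i) = if j = i then 1 else 0 := by
  have h1 := low_coeff (phi_bas j.2 _ j.1 rfl) (lead i) h
  rw [AddMonoidAlgebra.coeff_sub, Finsupp.sub_apply, sub_eq_zero] at h1
  rw [h1, AddMonoidAlgebra.coeff_single, Finsupp.single_apply]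
  simp only [Prod.mk.eta, lead_injective.eq_iff]

lemma bas_linearIndependent {d : ℕ} : LinearIndependent ℂ (fun i => phi d (bas i)) := by
  rw [linearIndependent_iff]
  intro c hc
  by_contra hne
  obtain ⟨i, hi, hmax⟩ := Finset.exists_max_image c.support (fun i => wt (lead i).2)
    (Finsupp.support_nonempty_iff.2 hne)
  have := congrArg (fun x : AddMonoidAlgebra ℂ (ℕ × (Fin d → ℕ)) => x.coeff (lead i)) hc
  simp only [Finsupp.linearCombination_apply, Finsupp.sum, AddMonoidAlgebra.coeff_sum,
    AddMonoidAlgebra.coeff_smul, Finsupp.finsetSum_apply, Finsupp.smul_apply,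
    AddMonoidAlgebra.coeff_zero, Finsupp.zero_apply] at this
  rw [Finset.sum_congr rfl (fun j hj => by rw [bas_coeff i j (hmax j hj)])] at this
  simp at this
  exact (Finsupp.mem_support_iff.1 hi) this

lemma single_mem_span {d : ℕ} (w : ℕ) : ∀ g : ℕ × (Fin d → ℕ), (∀ i, g.2 i ≤ g.1) → wt g.2 < w →
    AddMonoidAlgebra.single g (1 : ℂ) ∈ Submodule.span ℂ (Set.range (fun i => phi d (bas i))) := by
  induction w with
  | zero => intro g _ h; omega
  | succ w ih =>
    intro g hg hw
    obtain ⟨π, α, hα⟩ := pt_surjective g.1 g.2 hg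
    have hl : lead (α, π) = g := hα
    have h1 := phi_bas π _ α rfl
    rw [hl] at h1
    have hlow : low d (wt g.2) ≤ Submodule.span ℂ (Set.range (fun i => phi d (bas i))) := by
      apply Submodule.span_le.2
      rintro x ⟨g', h1, h2, rfl⟩
      exact ih g' h1 (by omega)
    have h2 : phi d (bas (α, π)) ∈ Submodule.span ℂ (Set.range (fun i => phi d (bas i))) :=
      Submodule.subset_span ⟨_, rfl⟩
    have := Submodule.sub_mem _ h2 (hlow h1)
    simpa using this

lemma ls_le {d : ℕ} (l : List (Fin d → Fin 2)) (i : Fin d) : (ls l).2 i ≤ (ls l).1 := by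
  induction l with
  | nil => simp [ls]
  | cons v l ih =>
    have : ls (v :: l) = (1, vv v) + ls l := by simp [ls]
    rw [this]
    exact add_le_add (vv_le v i) ih

lemma exists_rep {d : ℕ} (f : MvPolynomial (Fin d → Fin 2) ℂ) :
    ∃ c : ((Fin (d + 1) → ℕ) × Equiv.Perm (Fin d)) →₀ ℂ,
      f - Finsupp.linearCombination ℂ bas c ∈ cubeIdeal d := by
  have hf : phi d f ∈ Submodule.span ℂ (Set.range (fun i => phi d (bas i))) := by
    induction f using MvPolynomial.induction_on' with
    | monomial s a =>
      obtain ⟨l, hl⟩ := monomial_eq_lp s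
      have : monomial s a = a • lp l := by rw [← hl, smul_monomial]; simp
      rw [this, map_smul, phi_lp]
      exact Submodule.smul_mem _ _ (single_mem_span _ _ (ls_le l) (Nat.lt_succ_self _))
    | add p q hp hq => rw [map_add]; exact Submodule.add_mem _ hp hq
  obtain ⟨c, hc⟩ := (Finsupp.mem_span_range_iff_exists_finsupp).1 hf
  refine ⟨c, mem_cubeIdeal_of_phi ?_⟩
  rw [map_sub, sub_eq_zero, ← hc, Finsupp.linearCombination_apply, map_finsuppSum]
  simp

/-- Indices with a positive exponent below `k`. -/
def bad (d k : ℕ) : Set ((Fin (d + 1) → ℕ) × Equiv.Perm (Fin d)) :=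
  {i | ∃ j : Fin (d + 1), (j : ℕ) < k ∧ 0 < i.1 j}

lemma phi_cubeJ {d k : ℕ} (hk : k ≤ d + 1) {f : MvPolynomial (Fin d → Fin 2) ℂ}
    (hf : f ∈ cubeJ d k) :
    phi d f ∈ Submodule.span ℂ ((fun i => phi d (bas i)) '' bad d k) := by
  unfold cubeJ at hf
  obtain ⟨a, ha, b, hb, rfl⟩ := Submodule.mem_sup.1 hf
  rw [map_add, phi_cubeIdeal ha, zero_add]
  clear ha hf
  have main : ∀ r : MvPolynomial (Fin d → Fin 2) ℂ, phi d (r * b) ∈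
      Submodule.span ℂ ((fun i => phi d (bas i)) '' bad d k) := by
    induction hb using Submodule.span_induction with
    | zero => simp
    | add x y _ _ hx hy =>
      intro r; rw [mul_add, map_add]; exact Submodule.add_mem _ (hx r) (hy r)
    | mem x h =>
      intro r
      obtain ⟨j, _, rfl⟩ := h
      obtain ⟨c, hc⟩ := exists_rep r
      have h1 := phi_cubeIdeal hc
      rw [map_sub, sub_eq_zero] at h1
      rw [map_mul, h1, ← map_mul, Finsupp.linearCombination_apply, Finsupp.sum, Finset.sum_mul,
        map_sum]
      refine Submodule.sum_mem _ fun i _ => ?_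
      rw [smul_mul_assoc, map_smul]
      refine Submodule.smul_mem _ _ (Submodule.subset_span ?_)
      have hj : (j : ℕ) < d + 1 := by omega
      refine ⟨(i.1 + Pi.single (⟨j, hj⟩ : Fin (d + 1)) 1, i.2), ⟨⟨j, hj⟩, j.2, by simp⟩, ?_⟩
      simp only
      rw [← cubeY_mul_bas, mul_comm]
    | smul s x _ hx =>
      intro r
      rw [smul_eq_mul, ← mul_assoc]
      exact hx (r * s)
  simpa using main 1

lemma bas_mem_cubeJ {d k : ℕ} (i : (Fin (d + 1) → ℕ) × Equiv.Perm (Fin d)) (hi : i ∈ bad d k) :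
    bas i ∈ cubeJ d k := by
  obtain ⟨α, π⟩ := i
  obtain ⟨j, hj, hpos⟩ := hi
  obtain ⟨β, rfl⟩ : ∃ β : Fin (d + 1) → ℕ, α = β + Pi.single j 1 := by
    refine ⟨α - Pi.single j 1, (tsub_add_cancel_of_le ?_).symm⟩
    intro l
    by_cases h : l = j
    · subst h; simp only [Pi.single_eq_same]; exact hpos
    · simp [Pi.single_eq_of_ne h]
  rw [← cubeY_mul_bas]
  apply Ideal.mul_mem_right
  apply Ideal.mem_sup_right
  exact Ideal.subset_span ⟨⟨j, hj⟩, trivial, rfl⟩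

lemma regular {d k : ℕ} (hk : k ≤ d) (f : MvPolynomial (Fin d → Fin 2) ℂ)
    (hf : cubeY d k * f ∈ cubeJ d k) : f ∈ cubeJ d k := by
  obtain ⟨c, hc⟩ := exists_rep f
  have h1 := phi_cubeIdeal hc
  rw [map_sub, sub_eq_zero] at h1
  have h2 := phi_cubeJ (by omega) hf
  let kk : Fin (d + 1) := ⟨k, by omega⟩
  let sh : ((Fin (d + 1) → ℕ) × Equiv.Perm (Fin d)) → ((Fin (d + 1) → ℕ) × Equiv.Perm (Fin d)) :=
    fun i => (i.1 + Pi.single kk 1, i.2)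
  have hsh : Function.Injective sh := by
    rintro ⟨a, b⟩ ⟨a', b'⟩ h
    simp only [sh, Prod.mk.injEq, add_left_inj] at h
    rw [h.1, h.2]
  have h3 : phi d (cubeY d k * f)
      = Finsupp.linearCombination ℂ (fun i => phi d (bas i)) (c.mapDomain sh) := by
    rw [map_mul, h1, ← map_mul, Finsupp.linearCombination_mapDomain,
      Finsupp.linearCombination_apply, Finsupp.linearCombination_apply, Finsupp.sum, Finsupp.sum,
      Finset.mul_sum, map_sum]
    refine Finset.sum_congr rfl fun i _ => ?_
    rw [mul_smul_comm, map_smul]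
    simp only [Function.comp, sh]
    rw [← cubeY_mul_bas]
  rw [h3] at h2
  obtain ⟨c', hc', he⟩ := (Finsupp.mem_span_image_iff_linearCombination ℂ).1 h2
  have hcc : c' = c.mapDomain sh := bas_linearIndependent he
  have hbad : ∀ i ∈ c.support, i ∈ bad d k := by
    intro i hi
    have : sh i ∈ c'.support := by
      rw [hcc, Finsupp.mem_support_iff, Finsupp.mapDomain_apply hsh]
      exact Finsupp.mem_support_iff.1 hi
    obtain ⟨j, hj, hpos⟩ := (Finsupp.mem_supported ℂ c').1 hc' this
    refine ⟨j, hj, ?_⟩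
    have hne : j ≠ kk := by
      intro h; rw [h] at hj; simp [kk] at hj
    simpa [sh, Pi.single_eq_of_ne hne] using hpos
  have hsum : Finsupp.linearCombination ℂ bas c ∈ cubeJ d k := by
    rw [Finsupp.linearCombination_apply]
    refine Ideal.sum_mem _ fun i hi => ?_
    simp only [smul_eq_C_mul]
    exact Ideal.mul_mem_left _ _ (bas_mem_cubeJ i (hbad i hi))
  have hI : f - Finsupp.linearCombination ℂ bas c ∈ cubeJ d k := Ideal.mem_sup_left hc
  have := Ideal.add_mem _ hI hsum
  rwa [sub_add_cancel] at this

lemma proper (d k : ℕ) : cubeJ d k ≠ ⊤ := by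
  have hle : cubeJ d k ≤ RingHom.ker (constantCoeff (σ := Fin d → Fin 2) (R := ℂ)) := by
    refine sup_le (Ideal.span_le.2 ?_) (Ideal.span_le.2 ?_)
    · rintro p ⟨v, w, v', w', -, rfl⟩
      simp [RingHom.mem_ker]
    · rintro p ⟨j, -, rfl⟩
      simp [RingHom.mem_ker, cubeY]
  intro h
  have : (1 : MvPolynomial (Fin d → Fin 2) ℂ) ∈ cubeJ d k := by rw [h]; trivial
  have := hle this
  simp [RingHom.mem_ker] at this

end CubeReg

/-- The images `[y_0], …, [y_d]` in `R_{C_d} = S / I_{C_d}` form a regular sequence: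
for each `0 ≤ k ≤ d`, multiplication by `[y_k]` is injective on the quotient
`R_{C_d}/([y_0],…,[y_{k−1}])`, and `R_{C_d}/([y_0],…,[y_d]) ≠ 0`.  Phrased in `S`:
`y_k · f ∈ I_{C_d} + (y_0,…,y_{k−1})` implies `f ∈ I_{C_d} + (y_0,…,y_{k−1})`, and
`I_{C_d} + (y_0,…,y_d) ≠ S`. -/
theorem cubeY_regular_sequence (d : ℕ) (hd : 1 ≤ d) :
    (∀ k ≤ d, ∀ f : MvPolynomial (Fin d → Fin 2) ℂ,
        cubeY d k * f ∈ cubeJ d k → f ∈ cubeJ d k) ∧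
    cubeJ d (d + 1) ≠ ⊤ := by
  exact ⟨fun k hk f hf => CubeReg.regular hk f hf, CubeReg.proper d (d + 1)⟩
end

section
/- Let d ≥ 1, let S = ℂ[x_v : v ∈ {0,1}^d], let I_{C_d} ⊆ S be the ideal generated by all binomials x_v x_w − x_{v'} x_{w'} with v + w = v' + w' in ℤ^d, and for 0 ≤ k ≤ d let y_k = ∑_{v ∈ {0,1}^d, v_1+⋯+v_d = k} x_v. Let J = I_{C_d} + (y_0,…,y_d). For each pair (r,k) ∈ ℕ², let S_{(r,k)} ⊆ S be the ℂ-linear span of the monomials that have total degree r and weight k, where the weight of x_v is v_1+⋯+v_d. Then for every (r,k), the ℂ-dimension of the quotient S_{(r,k)}/(S_{(r,k)} ∩ J) equals the number of permutations σ ∈ S_d with desc(σ) = r and maj(σ) = k. (In other words, the bigraded Hilbert series of T_{C_d} = S/J is the refined Eulerian polynomial Ã_d(t,q) = ∑_{σ∈S_d} q^{maj(σ)} t^{desc(σ)}.) -/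
open MvPolynomial

/-- The bihomogeneous component `S_{(r,k)}`: the `ℂ`-span of the monomials of total degree
`r` and weight `k`, where the variable `x_v` has weight `v₁ + ⋯ + v_d`. -/
noncomputable def cubeComponent (d r k : ℕ) :
    Submodule ℂ (MvPolynomial (Fin d → Fin 2) ℂ) :=
  Submodule.span ℂ { m | ∃ s : (Fin d → Fin 2) →₀ ℕ,
    (s.sum fun _ n => n) = r ∧ (s.sum fun v n => n * ∑ i, (v i : ℕ)) = k ∧
    m = monomial s (1 : ℂ) }

open scoped Classical in
/-- The descent set of a permutation `σ` of `{1,…,d}` (0-indexed): the set of `i : Fin d`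
such that position `i+1` (1-based) is a descent, i.e. `σ(i) > σ(i+1)`. -/
noncomputable def descentSet {d : ℕ} (σ : Equiv.Perm (Fin d)) : Finset (Fin d) :=
  Finset.univ.filter fun i => ∃ h : (i : ℕ) + 1 < d, σ ⟨(i : ℕ) + 1, h⟩ < σ i

/-- The number of descents of a permutation. -/
noncomputable def desc {d : ℕ} (σ : Equiv.Perm (Fin d)) : ℕ := (descentSet σ).card

/-- The major index of a permutation: the sum of its (1-based) descent positions. -/
noncomputable def maj {d : ℕ} (σ : Equiv.Perm (Fin d)) : ℕ :=
  ∑ i ∈ descentSet σ, ((i : ℕ) + 1)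


namespace CubeT

/-- The ambient monoid of exponents. -/
abbrev M (d : ℕ) := ℕ × (Fin d → ℕ)

/-- The ambient ring. -/
abbrev R (d : ℕ) := AddMonoidAlgebra ℂ (M d)

/-- The ring of the statement. -/
abbrev S (d : ℕ) := MvPolynomial (Fin d → Fin 2) ℂ

/-- basis monomials of the ambient ring -/
noncomputable def mon {d : ℕ} (e : M d) : R d := AddMonoidAlgebra.single e 1

lemma mon_add {d : ℕ} (e f : M d) : mon (e + f) = mon e * mon f := by
  simp [mon, AddMonoidAlgebra.single_mul_single]

lemma mon_zero {d : ℕ} : mon (0 : M d) = 1 := rfl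

lemma mon_sum {d : ℕ} {ι : Type*} (s : Finset ι) (f : ι → M d) :
    mon (∑ i ∈ s, f i) = ∏ i ∈ s, mon (f i) := by
  classical
  induction s using Finset.induction_on with
  | empty => simp [mon_zero]
  | insert a s ha ih => rw [Finset.sum_insert ha, Finset.prod_insert ha, mon_add, ih]

lemma mon_nsmul {d : ℕ} (n : ℕ) (e : M d) : mon (n • e) = mon e ^ n := by
  induction n with
  | zero => simp [mon_zero]
  | succ n ih => rw [succ_nsmul, mon_add, ih, pow_succ]

lemma mon_injective {d : ℕ} : Function.Injective (mon : M d → R d) := by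
  intro a b h
  have := congrArg (fun x => x.coeff a) h
  simp only [mon, AddMonoidAlgebra.coeff_single, Finsupp.single_apply] at this
  by_contra hne
  simp [Ne.symm hne] at this

lemma coeff_mon {d : ℕ} (e f : M d) : (mon e).coeff f = if e = f then 1 else 0 := by
  simp [mon, AddMonoidAlgebra.coeff_single, Finsupp.single_apply]

/-- coordinates of a vertex -/
def vec {d : ℕ} (v : Fin d → Fin 2) : Fin d → ℕ := fun i => (v i : ℕ)

/-- lifted vertex -/
def ev {d : ℕ} (v : Fin d → Fin 2) : M d := (1, vec v)

lemma ev_injective {d : ℕ} : Function.Injective (ev : (Fin d → Fin 2) → M d) := by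
  intro v w h
  funext i
  have := congrFun (congrArg Prod.snd h) i
  exact Fin.ext this

/-- the toric map -/
noncomputable def phi (d : ℕ) : S d →ₐ[ℂ] R d := aeval (fun v => mon (ev v))

lemma phi_X {d : ℕ} (v : Fin d → Fin 2) : phi d (X v) = mon (ev v) := by
  simp [phi]

lemma cubeIdeal_le_ker {d : ℕ} {p : S d} (hp : p ∈ cubeIdeal d) : phi d p = 0 := by
  have : cubeIdeal d ≤ RingHom.ker (phi d) := by
    unfold cubeIdeal
    rw [Ideal.span_le]
    rintro _ ⟨v, w, v', w', h, rfl⟩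
    simp only [SetLike.mem_coe, RingHom.mem_ker, map_sub, map_mul, phi_X]
    rw [← mon_add, ← mon_add, sub_eq_zero]
    congr 1
    refine Prod.ext rfl ?_
    funext i
    exact h i
  exact this hp

/-- monomial of a multiset of vertices -/
noncomputable def xm {d : ℕ} (W : Multiset (Fin d → Fin 2)) : S d := (W.map X).prod

/-- exponent of a multiset of vertices -/
def ex {d : ℕ} (W : Multiset (Fin d → Fin 2)) : M d := (W.map ev).sum

lemma phi_xm {d : ℕ} (W : Multiset (Fin d → Fin 2)) : phi d (xm W) = mon (ex W) := by
  induction W using Multiset.induction_on with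
  | empty => simp [xm, ex, mon_zero]
  | cons a W ih =>
    have h1 : xm (a ::ₘ W) = X a * xm W := by simp [xm]
    have h2 : ex (a ::ₘ W) = ev a + ex W := by simp [ex]
    rw [h1, h2, map_mul, phi_X, ih, mon_add]

lemma ex_fst {d : ℕ} (W : Multiset (Fin d → Fin 2)) : (ex W).1 = W.card := by
  induction W using Multiset.induction_on with
  | empty => simp [ex]
  | cons a W ih =>
    have h2 : ex (a ::ₘ W) = ev a + ex W := by simp [ex]
    rw [h2, Prod.fst_add, ih, Multiset.card_cons, add_comm]; rfl

/-- support vertex -/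
def supV {d : ℕ} (a : Fin d → ℕ) : Fin d → Fin 2 := fun i => if a i = 0 then 0 else 1

lemma supV_vec {d : ℕ} (v : Fin d → Fin 2) : supV (vec v) = v := by
  funext i
  have key : ∀ x : Fin 2, (if (x : ℕ) = 0 then (0 : Fin 2) else 1) = x := by decide
  exact key (v i)


lemma mk_swap {d : ℕ} (v w v' w' : Fin d → Fin 2) (h : ev v + ev w = ev v' + ev w') :
    Ideal.Quotient.mk (cubeIdeal d) (X v * X w) = Ideal.Quotient.mk (cubeIdeal d) (X v' * X w') := by
  rw [Ideal.Quotient.eq]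
  apply Ideal.subset_span
  exact ⟨v, w, v', w', fun i => congrFun (congrArg Prod.snd h) i, rfl⟩

lemma ex_eq_of_mk {d : ℕ} {W W' : Multiset (Fin d → Fin 2)} (h : Ideal.Quotient.mk (cubeIdeal d) (xm W) = Ideal.Quotient.mk (cubeIdeal d) (xm W')) :
    ex W = ex W' := by
  rw [Ideal.Quotient.eq] at h
  have := cubeIdeal_le_ker h
  rw [map_sub, phi_xm, phi_xm, sub_eq_zero] at this
  exact mon_injective this

lemma xm_cons {d : ℕ} (v : Fin d → Fin 2) (W) : xm (v ::ₘ W) = X v * xm W := by simp [xm]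

lemma ex_cons {d : ℕ} (v : Fin d → Fin 2) (W) : ex (v ::ₘ W) = ev v + ex W := by simp [ex]

lemma extract {d : ℕ} (W : Multiset (Fin d → Fin 2)) : ∀ v : Fin d → Fin 2,
    ∃ W', Ideal.Quotient.mk (cubeIdeal d) (xm (v ::ₘ W)) = Ideal.Quotient.mk (cubeIdeal d) (xm (supV (ex (v ::ₘ W)).2 ::ₘ W')) := by
  induction W using Multiset.induction_on with
  | empty =>
    intro v
    refine ⟨0, ?_⟩
    have : (ex (v ::ₘ 0)).2 = vec v := by simp [ex, ev]
    rw [this, supV_vec]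
  | cons w W ih =>
    intro v
    obtain ⟨W', hW'⟩ := ih w
    set u := supV (ex (w ::ₘ W)).2 with hu
    set a := (ex (v ::ₘ w ::ₘ W)).2 with ha
    have haa : ∀ i, a i = vec v i + (ex (w ::ₘ W)).2 i := by
      intro i; rw [ha, ex_cons]; rfl
    refine ⟨(fun i => if v i = 0 ∨ u i = 0 then 0 else 1) ::ₘ W', ?_⟩
    rw [xm_cons, map_mul, hW', xm_cons, xm_cons, xm_cons, ← map_mul, ← mul_assoc, ← mul_assoc,
      map_mul, map_mul _ _ (xm W')]
    congr 1
    apply mk_swap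
    refine Prod.ext rfl ?_
    funext i
    change (v i : ℕ) + (u i : ℕ) = (supV a i : ℕ) + ((if v i = 0 ∨ u i = 0 then 0 else 1 : Fin 2) : ℕ)
    have h1 : supV a i = if v i = 0 ∧ u i = 0 then 0 else 1 := by
      simp only [supV, haa, hu, vec]
      have : ((v i : ℕ) = 0) ↔ v i = 0 := by rw [Fin.ext_iff]; rfl
      by_cases h1 : v i = 0 <;> by_cases h2 : (ex (w ::ₘ W)).2 i = 0 <;> simp [h1, h2]
    rw [h1]
    generalize v i = x
    generalize u i = y
    revert x y
    decide

lemma mk_eq_of_ex {d : ℕ} (n : ℕ) : ∀ W W' : Multiset (Fin d → Fin 2), W.card = n →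
    ex W = ex W' → Ideal.Quotient.mk (cubeIdeal d) (xm W) = Ideal.Quotient.mk (cubeIdeal d) (xm W') := by
  induction n with
  | zero =>
    intro W W' h0 h
    have h1 : W'.card = 0 := by rw [← ex_fst, ← h, ex_fst, h0]
    rw [Multiset.card_eq_zero] at h0 h1
    rw [h0, h1]
  | succ n ih =>
    intro W W' h0 h
    have h1 : W'.card = n + 1 := by rw [← ex_fst, ← h, ex_fst, h0]
    obtain ⟨v, hv⟩ := Multiset.card_pos_iff_exists_mem.1 (by omega : 0 < W.card)
    obtain ⟨W, rfl⟩ := Multiset.exists_cons_of_mem hv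
    obtain ⟨v', hv'⟩ := Multiset.card_pos_iff_exists_mem.1 (by omega : 0 < W'.card)
    obtain ⟨W', rfl⟩ := Multiset.exists_cons_of_mem hv'
    obtain ⟨U, hU⟩ := extract W v
    obtain ⟨U', hU'⟩ := extract W' v'
    rw [← h] at hU'
    have e1 := ex_eq_of_mk hU
    have e2 := ex_eq_of_mk hU'
    rw [hU, hU', xm_cons, xm_cons, map_mul, map_mul]
    congr 1
    apply ih
    · have := congrArg Prod.fst e1
      rw [ex_fst, ex_fst, h0, Multiset.card_cons] at this
      omega
    · have e3 := e1.symm.trans (h.trans e2)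
      rw [ex_cons _ U, ex_cons _ U'] at e3
      exact add_left_cancel e3

lemma monomial_eq_xm {d : ℕ} (s : (Fin d → Fin 2) →₀ ℕ) :
    (monomial s (1 : ℂ) : S d) = xm (Finsupp.toMultiset s) := by
  rw [xm, Finsupp.toMultiset_map, Finsupp.prod_toMultiset, monomial_eq]
  simp [Finsupp.prod_mapDomain_index, pow_add]

lemma ker_le_cubeIdeal {d : ℕ} {p : S d} (hp : phi d p = 0) : p ∈ cubeIdeal d := by
  classical
  let N : M d → S d ⧸ cubeIdeal d := fun e =>
    if h : ∃ W, ex W = e then Ideal.Quotient.mk (cubeIdeal d) (xm h.choose) else 0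
  let Psi : R d →ₗ[ℂ] (S d ⧸ cubeIdeal d) :=
    (Finsupp.linearCombination ℂ N) ∘ₗ (AddMonoidAlgebra.coeffLinearEquiv ℂ).toLinearMap
  have key : Psi ∘ₗ (phi d).toLinearMap = (Ideal.Quotient.mkₐ ℂ (cubeIdeal d)).toLinearMap := by
    apply (basisMonomials (Fin d → Fin 2) ℂ).ext
    intro s
    rw [coe_basisMonomials]
    simp only [LinearMap.comp_apply, AlgHom.toLinearMap_apply]
    rw [monomial_eq_xm, phi_xm]
    have h : ∃ W, ex W = ex (Finsupp.toMultiset s) := ⟨_, rfl⟩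
    have : Psi (mon (ex (Finsupp.toMultiset s))) = N (ex (Finsupp.toMultiset s)) := by
      simp [Psi, mon]
    rw [this]
    simp only [N]
    rw [dif_pos h]
    exact mk_eq_of_ex _ _ _ rfl h.choose_spec
  rw [← Ideal.Quotient.eq_zero_iff_mem]
  have := congrArg (fun f => f p) key
  simp only [LinearMap.comp_apply, AlgHom.toLinearMap_apply, hp, map_zero] at this
  exact this.symm

/-- vertex given by the first `k` values of `σ` -/
def topV {d : ℕ} (σ : Equiv.Perm (Fin d)) (k : ℕ) : Fin d → Fin 2 :=
  fun j => if (σ.symm j : ℕ) < k then 1 else 0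

open scoped Classical in
/-- descent indicator, by 1-based positions -/
noncomputable def D {d : ℕ} (σ : Equiv.Perm (Fin d)) : Fin (d + 1) → ℕ :=
  Fin.cases 0 (fun i => if i ∈ descentSet σ then 1 else 0)

/-- leading exponent -/
noncomputable def lead {d : ℕ} (σ : Equiv.Perm (Fin d)) (m : Fin (d + 1) → ℕ) : M d :=
  ∑ k : Fin (d + 1), (m k + D σ k) • ev (topV σ k)

/-- Garsia-Stanton type elements -/
noncomputable def F {d : ℕ} (σ : Equiv.Perm (Fin d)) (m : Fin (d + 1) → ℕ) : S d :=
  (∏ k : Fin (d + 1), X (topV σ k) ^ (D σ k)) * ∏ k : Fin (d + 1), cubeY d k ^ m k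

/-- sorting key -/
def key {d : ℕ} (a : Fin d → ℕ) (i : Fin d) : ℕ := d * a i + (Fin.rev i : ℕ)

/-- quadratic weight -/
def Phi {d : ℕ} (a : Fin d → ℕ) : ℕ := ∑ i, (d * a i ^ 2 + 2 * ((Fin.rev i : ℕ) * a i))

lemma vec_topV {d : ℕ} (σ : Equiv.Perm (Fin d)) (k : ℕ) (i : Fin d) :
    vec (topV σ k) (σ i) = if (i : ℕ) < k then 1 else 0 := by
  simp only [vec, topV, Equiv.symm_apply_apply]
  split_ifs <;> rfl

lemma lead_fst {d : ℕ} (σ : Equiv.Perm (Fin d)) (m : Fin (d + 1) → ℕ) :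
    (lead σ m).1 = ∑ k, (m k + D σ k) := by
  simp [lead, Prod.fst_sum, ev]

lemma lead_snd {d : ℕ} (σ : Equiv.Perm (Fin d)) (m : Fin (d + 1) → ℕ) (i : Fin d) :
    (lead σ m).2 (σ i) = ∑ k : Fin (d + 1), if (i : ℕ) < k then (m k + D σ k) else 0 := by
  simp only [lead, Prod.snd_sum, Finset.sum_apply]
  refine Finset.sum_congr rfl fun k _ => ?_
  have := vec_topV σ k i
  simp only [ev, Prod.smul_snd, Pi.smul_apply, this, smul_eq_mul]
  split_ifs <;> simp

lemma tail_step {n : ℕ} (N : Fin n → ℕ) (t : ℕ) (ht : t < n) :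
    (∑ k : Fin n, if t ≤ (k : ℕ) then N k else 0) =
      N ⟨t, ht⟩ + ∑ k : Fin n, if t < (k : ℕ) then N k else 0 := by
  classical
  have h : N ⟨t, ht⟩ = ∑ k : Fin n, if k = ⟨t, ht⟩ then N k else 0 := by simp
  rw [h, ← Finset.sum_add_distrib]
  refine Finset.sum_congr rfl fun k _ => ?_
  by_cases h1 : k = ⟨t, ht⟩
  · subst h1; simp
  · have h2 : (k : ℕ) ≠ t := fun h => h1 (Fin.ext h)
    have h3 : t ≤ (k : ℕ) ↔ t < (k : ℕ) := by omega
    simp [h1, h3]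

lemma lead_step {n : ℕ} (σ : Equiv.Perm (Fin (n + 1))) (m : Fin (n + 2) → ℕ) (i : Fin n) :
    (lead σ m).2 (σ i.castSucc) = (m i.castSucc.succ + D σ i.castSucc.succ) +
      (lead σ m).2 (σ i.succ) := by
  rw [lead_snd, lead_snd]
  have := tail_step (fun k => m k + D σ k) ((i : ℕ) + 1) (by omega)
  simp only [Nat.succ_le_iff] at this
  exact this

lemma mem_descentSet {n : ℕ} (σ : Equiv.Perm (Fin (n + 1))) (i : Fin n) :
    i.castSucc ∈ descentSet σ ↔ σ i.succ < σ i.castSucc := by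
  classical
  simp only [descentSet, Finset.mem_filter, Finset.mem_univ, true_and]
  constructor
  · rintro ⟨_, h⟩; exact h
  · intro h; exact ⟨by simp, h⟩

lemma D_succ {d : ℕ} (σ : Equiv.Perm (Fin d)) (i : Fin d) [Decidable (i ∈ descentSet σ)] :
    D σ i.succ = if i ∈ descentSet σ then 1 else 0 := by
  simp only [D, Fin.cases_succ]
  congr

lemma lead_strictAnti {d : ℕ} (σ : Equiv.Perm (Fin d)) (m : Fin (d + 1) → ℕ) :
    StrictAnti (fun i => key (lead σ m).2 (σ i)) := by
  classical
  cases d with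
  | zero => intro i; exact i.elim0
  | succ n =>
    rw [Fin.strictAnti_iff_succ_lt]
    intro i
    simp only [key, lead_step, D_succ, mem_descentSet, Fin.val_rev]
    have h1 := (σ i.succ).isLt
    have h2 := (σ i.castSucc).isLt
    have hne : σ i.succ ≠ σ i.castSucc := by
      intro h
      have := congrArg Fin.val (σ.injective h)
      simp at this
    split_ifs with h
    · have e : (n + 1) * (m i.castSucc.succ + 1 + (lead σ m).2 (σ i.succ)) =
        (n + 1) * m i.castSucc.succ + (n + 1) + (n + 1) * (lead σ m).2 (σ i.succ) := by ring
      rw [e]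
      omega
    · have h3 : (σ i.castSucc : ℕ) < σ i.succ := by
        have := lt_of_le_of_ne (not_lt.1 h) hne.symm
        exact this
      have e : (n + 1) * (m i.castSucc.succ + 0 + (lead σ m).2 (σ i.succ)) =
        (n + 1) * m i.castSucc.succ + (n + 1) * (lead σ m).2 (σ i.succ) := by ring
      rw [e]
      omega

lemma sum_ite_lt {d k : ℕ} (hk : k ≤ d) : (∑ i : Fin d, if (i : ℕ) < k then 1 else 0) = k := by
  rw [Fin.sum_univ_eq_sum_range (fun i => if i < k then 1 else 0) d]
  rw [← Finset.sum_filter]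
  have : (Finset.range d).filter (fun i => i < k) = Finset.range k := by
    ext i; simp; omega
  rw [this]; simp

lemma sum_vec_topV {d : ℕ} (σ : Equiv.Perm (Fin d)) {k : ℕ} (hk : k ≤ d) :
    ∑ i, vec (topV σ k) i = k := by
  rw [← Equiv.sum_comp σ]
  simp only [vec_topV]
  exact sum_ite_lt hk

lemma vec_le_one {d : ℕ} (v : Fin d → Fin 2) (i : Fin d) : vec v i ≤ 1 := by
  have := (v i).isLt
  simp only [vec]; omega

lemma exists_threshold {d : ℕ} (κ : Fin d → ℕ) (hκ : StrictAnti κ) (k : ℕ) (hk : k ≤ d) :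
    ∃ T : ℤ, ∀ i : Fin d, ((i : ℕ) < k → 1 ≤ 2 * (κ i : ℤ) - T) ∧
      (k ≤ (i : ℕ) → 2 * (κ i : ℤ) - T ≤ -1) := by
  cases k with
  | zero =>
    refine ⟨2 * (∑ i, (κ i : ℤ)) + 1, fun i => ⟨fun h => by omega, fun _ => ?_⟩⟩
    have : (κ i : ℤ) ≤ ∑ i, (κ i : ℤ) :=
      Finset.single_le_sum (f := fun i => (κ i : ℤ)) (fun i _ => by positivity) (Finset.mem_univ i)
    linarith
  | succ k =>
    refine ⟨2 * (κ ⟨k, hk⟩ : ℤ) - 1, fun i => ⟨fun h => ?_, fun h => ?_⟩⟩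
    · have : κ ⟨k, hk⟩ ≤ κ i := hκ.antitone (by rw [Fin.le_def]; simp; omega)
      omega
    · have : κ i < κ ⟨k, hk⟩ := hκ (by rw [Fin.lt_def]; simp; omega)
      omega

lemma rearr {d : ℕ} (κ : Fin d → ℕ) (σ : Equiv.Perm (Fin d)) (hκ : StrictAnti fun i => κ (σ i))
    {k : ℕ} (hk : k ≤ d) (v : Fin d → Fin 2) (hv : ∑ i, vec v i = k) :
    ∑ i, κ i * vec v i ≤ ∑ i, κ i * vec (topV σ k) i ∧
      (v ≠ topV σ k → ∑ i, κ i * vec v i < ∑ i, κ i * vec (topV σ k) i) := by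
  obtain ⟨T, hT⟩ := exists_threshold _ hκ k hk
  have hs : ∑ i, vec v (σ i) = k := by rw [Equiv.sum_comp σ (vec v), hv]
  have ht : ∑ i, vec (topV σ k) (σ i) = k := by
    rw [Equiv.sum_comp σ (vec (topV σ k)), sum_vec_topV σ hk]
  have hterm : ∀ i, |(vec (topV σ k) (σ i) : ℤ) - vec v (σ i)| ≤
      (2 * (κ (σ i) : ℤ) - T) * ((vec (topV σ k) (σ i) : ℤ) - vec v (σ i)) := by
    intro i
    have h1 := vec_le_one v (σ i)
    rw [vec_topV]
    by_cases h : (i : ℕ) < k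
    · have := (hT i).1 h
      interval_cases hh : vec v (σ i)
      · simpa [h] using this
      · simp [h]
    · have := (hT i).2 (not_lt.1 h)
      interval_cases hh : vec v (σ i)
      · simp [h]
      · simp [h]; linarith
  have hsum := Finset.sum_le_sum (fun i (_ : i ∈ Finset.univ) => hterm i)
  have hR : ∑ i, (2 * (κ (σ i) : ℤ) - T) * ((vec (topV σ k) (σ i) : ℤ) - vec v (σ i)) =
      2 * (((∑ i, κ i * vec (topV σ k) i : ℕ) : ℤ) - ((∑ i, κ i * vec v i : ℕ) : ℤ)) := by
    rw [← Equiv.sum_comp σ (fun i => κ i * vec (topV σ k) i),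
      ← Equiv.sum_comp σ (fun i => κ i * vec v i)]
    have hs' : ∑ i, (vec v (σ i) : ℤ) = k := by exact_mod_cast hs
    have ht' : ∑ i, (vec (topV σ k) (σ i) : ℤ) = k := by exact_mod_cast ht
    have : ∀ i, (2 * (κ (σ i) : ℤ) - T) * ((vec (topV σ k) (σ i) : ℤ) - vec v (σ i)) =
      2 * ((κ (σ i) : ℤ) * (vec (topV σ k) (σ i) : ℤ)) - 2 * ((κ (σ i) : ℤ) * (vec v (σ i) : ℤ))
      - (T * (vec (topV σ k) (σ i) : ℤ) - T * (vec v (σ i) : ℤ)) := fun i => by ring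
    simp only [this, Finset.sum_sub_distrib, ← Finset.mul_sum, hs', ht']
    push_cast
    ring
  rw [hR] at hsum
  have h0 : 0 ≤ ∑ i, |(vec (topV σ k) (σ i) : ℤ) - vec v (σ i)| :=
    Finset.sum_nonneg fun i _ => abs_nonneg _
  refine ⟨by omega, fun hne => ?_⟩
  have hpos : 0 < ∑ i, |(vec (topV σ k) (σ i) : ℤ) - vec v (σ i)| := by
    rcases h0.lt_or_eq with h | h
    · exact h
    exfalso
    apply hne
    have := (Finset.sum_eq_zero_iff_of_nonneg (fun i _ => abs_nonneg _)).1 h.symm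
    funext j
    have h2 := this (σ.symm j) (Finset.mem_univ _)
    rw [abs_eq_zero, Equiv.apply_symm_apply] at h2
    apply Fin.ext
    have h3 : vec (topV σ k) j = vec v j := by omega
    exact h3.symm
  omega

lemma pair_le {d : ℕ} (σ : Equiv.Perm (Fin d)) {k l : ℕ} (hk : k ≤ d)
    (v w : Fin d → Fin 2) (hv : ∑ i, vec v i = k) (hw : ∑ i, vec w i = l) :
    ∑ i, vec v i * vec w i ≤ ∑ i, vec (topV σ k) i * vec (topV σ l) i := by
  have h1 : ∑ i, vec (topV σ k) i * vec (topV σ l) i = min k l := by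
    rw [← Equiv.sum_comp σ]
    simp only [vec_topV]
    rw [← sum_ite_lt (d := d) (k := min k l) (by omega)]
    refine Finset.sum_congr rfl fun i _ => ?_
    by_cases h1 : (i : ℕ) < k <;> by_cases h2 : (i : ℕ) < l <;> simp [h1, h2]
  rw [h1, le_min_iff]
  constructor
  · rw [← hv]
    refine Finset.sum_le_sum fun i _ => ?_
    have := vec_le_one w i
    nlinarith [Nat.zero_le (vec v i)]
  · rw [← hw]
    refine Finset.sum_le_sum fun i _ => ?_
    have := vec_le_one v i
    nlinarith [Nat.zero_le (vec w i)]

lemma Phi_expand {d : ℕ} {J : Type*} [Fintype J] (c : Fin d → ℕ) (p : J → Fin d → ℕ) :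
    Phi (c + ∑ j, p j) = Phi c + 2 * (∑ j, ∑ i, key c i * p j i) +
      d * ∑ j, ∑ j', ∑ i, p j i * p j' i := by
  have e1 : (∑ j, ∑ i, key c i * p j i) = ∑ i, key c i * ∑ j, p j i := by
    rw [Finset.sum_comm]
    simp only [Finset.mul_sum]
  have e2 : (∑ j, ∑ j', ∑ i, p j i * p j' i) = ∑ i, (∑ j, p j i) * (∑ j, p j i) := by
    simp only [Finset.sum_mul_sum]
    rw [Finset.sum_comm (s := (Finset.univ : Finset (Fin d)))]
    refine Finset.sum_congr rfl fun j _ => ?_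
    rw [Finset.sum_comm]
  rw [e1, e2, Phi, Phi, Finset.mul_sum, Finset.mul_sum, ← Finset.sum_add_distrib,
    ← Finset.sum_add_distrib]
  refine Finset.sum_congr rfl fun i _ => ?_
  simp only [Pi.add_apply, Finset.sum_apply, key]
  ring

lemma Phi_lt {d : ℕ} {J : Type*} [Fintype J] (c : Fin d → ℕ) (σ : Equiv.Perm (Fin d))
    (hc : StrictAnti fun i => key c (σ i)) (k : J → ℕ) (hk : ∀ j, k j ≤ d)
    (p : J → Fin d → Fin 2) (hp : ∀ j, ∑ i, vec (p j) i = k j)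
    (hne : p ≠ fun j => topV σ (k j)) :
    Phi (c + ∑ j, vec (p j)) < Phi (c + ∑ j, vec (topV σ (k j))) := by
  rw [Phi_expand, Phi_expand]
  have h1 : ∑ j, ∑ i, key c i * vec (p j) i < ∑ j, ∑ i, key c i * vec (topV σ (k j)) i := by
    apply Finset.sum_lt_sum
    · intro j _
      exact (rearr (key c) σ hc (hk j) (p j) (hp j)).1
    · by_contra hcon
      push Not at hcon
      apply hne
      funext j
      by_contra hj
      have := (rearr (key c) σ hc (hk j) (p j) (hp j)).2 hj
      exact absurd (hcon j (Finset.mem_univ _)) (not_le.2 this)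
  have h2 : ∑ j, ∑ j', ∑ i, vec (p j) i * vec (p j') i ≤
      ∑ j, ∑ j', ∑ i, vec (topV σ (k j)) i * vec (topV σ (k j')) i :=
    Finset.sum_le_sum fun j _ => Finset.sum_le_sum fun j' _ =>
      pair_le σ (hk j) _ _ (hp j) (hp j')
  have h3 := Nat.mul_le_mul_left d h2
  omega

/-- exponents occurring in the toric ring -/
def E (d : ℕ) : AddSubmonoid (M d) where
  carrier := {e | ∀ i, e.2 i ≤ e.1}
  zero_mem' := fun _ => le_rfl
  add_mem' := fun ha hb i => add_le_add (ha i) (hb i)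

/-- bidegree -/
def bd {d : ℕ} : M d →+ ℕ × ℕ where
  toFun e := (e.1, ∑ i, e.2 i)
  map_zero' := by simp
  map_add' a b := by simp [Finset.sum_add_distrib]

lemma ev_mem_E {d : ℕ} (v : Fin d → Fin 2) : ev v ∈ E d := fun i => vec_le_one v i

lemma bd_ev {d : ℕ} (v : Fin d → Fin 2) : bd (ev v) = (1, ∑ i, vec v i) := rfl

/-- exponent of the descent part -/
noncomputable def cexp {d : ℕ} (σ : Equiv.Perm (Fin d)) : M d :=
  ∑ k : Fin (d + 1), (D σ k) • ev (topV σ k)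

lemma cexp_eq {d : ℕ} (σ : Equiv.Perm (Fin d)) : cexp σ = lead σ 0 := by
  simp [cexp, lead]

lemma lead_eq {d : ℕ} (σ : Equiv.Perm (Fin d)) (m : Fin (d + 1) → ℕ) :
    lead σ m = cexp σ + ∑ j : (Σ k : Fin (d + 1), Fin (m k)), ev (topV σ j.1) := by
  rw [Fintype.sum_sigma]
  simp only [Finset.sum_const, Finset.card_univ, Fintype.card_fin]
  rw [lead, cexp, ← Finset.sum_add_distrib]
  refine Finset.sum_congr rfl fun k _ => ?_
  rw [add_nsmul, add_comm]

lemma phi_cubeY {d : ℕ} (k : ℕ) : phi d (cubeY d k) =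
    ∑ v ∈ Finset.univ.filter (fun v : Fin d → Fin 2 => ∑ i, (v i : ℕ) = k), mon (ev v) := by
  simp [cubeY, phi_X]

lemma phi_F_expand {d : ℕ} (σ : Equiv.Perm (Fin d)) (m : Fin (d + 1) → ℕ) :
    phi d (F σ m) = ∑ p ∈ Fintype.piFinset (fun j : (Σ k : Fin (d + 1), Fin (m k)) =>
      Finset.univ.filter (fun v : Fin d → Fin 2 => ∑ i, (v i : ℕ) = (j.1 : ℕ))),
      mon (cexp σ + ∑ j, ev (p j)) := by
  classical
  have h1 : (∏ k : Fin (d + 1), cubeY d k ^ m k) =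
      ∏ j : (Σ k : Fin (d + 1), Fin (m k)), cubeY d j.1 := by
    rw [Fintype.prod_sigma]; simp
  rw [F, h1, map_mul, map_prod, map_prod]
  simp only [map_pow, phi_X, phi_cubeY, Finset.prod_univ_sum, mon_add, mon_sum, cexp, mon_nsmul]
  rw [Finset.mul_sum]

/-- triangularity set -/
def lowerSet {d : ℕ} (e : M d) : Set (M d) :=
  {h | Phi h.2 < Phi e.2 ∧ bd h = bd e ∧ h ∈ E d}

lemma phi_F {d : ℕ} (σ : Equiv.Perm (Fin d)) (m : Fin (d + 1) → ℕ) :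
    phi d (F σ m) - mon (lead σ m) ∈ Submodule.span ℂ (mon '' lowerSet (lead σ m)) := by
  classical
  rw [phi_F_expand]
  set top : (Σ k : Fin (d + 1), Fin (m k)) → Fin d → Fin 2 := fun j => topV σ j.1 with htop
  have hmem : top ∈ Fintype.piFinset (fun j : (Σ k : Fin (d + 1), Fin (m k)) =>
      Finset.univ.filter (fun v : Fin d → Fin 2 => ∑ i, (v i : ℕ) = (j.1 : ℕ))) := by
    rw [Fintype.mem_piFinset]
    intro j
    simp only [Finset.mem_filter, Finset.mem_univ, true_and]
    exact sum_vec_topV σ (by omega)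
  rw [← Finset.add_sum_erase _ _ hmem, lead_eq, add_sub_cancel_left]
  refine Submodule.sum_mem _ fun p hp => Submodule.subset_span ⟨_, ?_, rfl⟩
  rw [Finset.mem_erase, Fintype.mem_piFinset] at hp
  obtain ⟨hne, hp⟩ := hp
  have hp' : ∀ j, ∑ i, vec (p j) i = (j.1 : ℕ) := fun j => by
    have := hp j
    simp only [Finset.mem_filter, Finset.mem_univ, true_and] at this
    exact this
  refine ⟨?_, ?_, ?_⟩
  · have hc : StrictAnti fun i => key (cexp σ).2 (σ i) := by
      rw [cexp_eq]; exact lead_strictAnti σ 0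
    have := Phi_lt (cexp σ).2 σ hc (fun j : (Σ k : Fin (d + 1), Fin (m k)) => (j.1 : ℕ))
      (fun j => by omega) p hp' hne
    simpa [Prod.snd_sum, ev] using this
  · simp only [map_add, map_sum, bd_ev, hp']
    congr 1
    refine Finset.sum_congr rfl fun j _ => ?_
    rw [sum_vec_topV σ (by omega)]
  · refine add_mem ?_ (sum_mem fun j _ => ev_mem_E _)
    exact sum_mem fun k _ => nsmul_mem (ev_mem_E _) _

lemma lead_mem_E {d : ℕ} (σ : Equiv.Perm (Fin d)) (m : Fin (d + 1) → ℕ) : lead σ m ∈ E d :=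
  sum_mem fun _ _ => nsmul_mem (ev_mem_E _) _

lemma key_injective {d : ℕ} (a : Fin d → ℕ) : Function.Injective (key a) := by
  intro i j h
  have h1 : ∀ i : Fin d, key a i % d = (Fin.rev i : ℕ) := by
    intro i
    rw [key, Nat.mul_add_mod, Nat.mod_eq_of_lt (Fin.rev i).isLt]
  have h2 : (Fin.rev i : ℕ) = Fin.rev j := by rw [← h1, ← h1, h]
  exact Fin.rev_injective (Fin.ext h2)

lemma tail_sum {n : ℕ} (N : Fin n → ℕ) (A : ℕ → ℕ) (hA : A n = 0)
    (h : ∀ t (ht : t < n), N ⟨t, ht⟩ + A (t + 1) = A t) (t : ℕ) (ht : t ≤ n) :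
    (∑ k : Fin n, if t ≤ (k : ℕ) then N k else 0) = A t := by
  induction ht using Nat.decreasingInduction with
  | self =>
    rw [hA]
    refine Finset.sum_eq_zero fun k _ => ?_
    rw [if_neg (by omega)]
  | of_succ t ht ih =>
    rw [tail_step N t ht, ← h t ht, ← ih]
    rfl

lemma lead_surj {d : ℕ} (e : M d) (he : e ∈ E d) : ∃ σ m, lead σ m = e := by
  classical
  obtain ⟨r, a⟩ := e
  let σ : Equiv.Perm (Fin d) := Tuple.sort (fun i => OrderDual.toDual (key a i))
  have hmono : Antitone (fun i => key a (σ i)) := by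
    have := Tuple.monotone_sort (fun i => OrderDual.toDual (key a i))
    intro i j hij
    exact this hij
  let A : ℕ → ℕ := fun t => if t = 0 then r else if h : t - 1 < d then a (σ ⟨t - 1, h⟩) else 0
  have hA0 : A 0 = r := rfl
  have hA1 : ∀ i : Fin d, A (i + 1) = a (σ i) := by
    intro i; simp [A]
  have hAd : A (d + 1) = 0 := by simp [A]
  have hstep : ∀ k : Fin (d + 1), D σ k + A ((k : ℕ) + 1) ≤ A k := by
    intro k
    refine Fin.cases ?_ (fun i => ?_) k
    · rw [Fin.val_zero, hA0]
      simp only [D, Fin.cases_zero, zero_add]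
      by_cases hd : 0 < d
      · have := hA1 ⟨0, hd⟩
        simp only [zero_add] at this
        rw [this]; exact he _
      · have : d = 0 := by omega
        subst this
        simp [A]
    · rw [Fin.val_succ, hA1, D_succ]
      by_cases hi : (i : ℕ) + 1 < d
      · have h1 := hA1 ⟨i + 1, hi⟩
        simp only at h1
        rw [h1]
        have h2 : key a (σ ⟨i + 1, hi⟩) ≤ key a (σ i) := hmono (by rw [Fin.le_def]; simp)
        simp only [key, Fin.val_rev] at h2
        have h3 := (σ i).isLt
        have h4 := (σ ⟨i + 1, hi⟩).isLt
        have hle : a (σ ⟨i + 1, hi⟩) ≤ a (σ i) := by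
          by_contra hcon
          have : d * (a (σ i) + 1) ≤ d * a (σ ⟨i + 1, hi⟩) := Nat.mul_le_mul_left d (by omega)
          rw [mul_add] at this
          omega
        split_ifs with hdes
        · have hdes' : σ ⟨i + 1, hi⟩ < σ i := by
            simp only [descentSet, Finset.mem_filter, Finset.mem_univ, true_and] at hdes
            exact hdes.2
          rw [Fin.lt_def] at hdes'
          by_contra hcon
          have : a (σ i) = a (σ ⟨i + 1, hi⟩) := by omega
          rw [this] at h2
          omega
        · omega
      · have hid : (i : ℕ) + 1 = d := by omega
        have hnd : i ∉ descentSet σ := by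
          simp only [descentSet, Finset.mem_filter, Finset.mem_univ, true_and]
          rintro ⟨h, _⟩; omega
        rw [hid, hAd, if_neg hnd]
        omega
  refine ⟨σ, fun k => A k - A (k + 1) - D σ k, ?_⟩
  have hN : ∀ k : Fin (d + 1), A k - A (k + 1) - D σ k + D σ k = A k - A (k + 1) := fun k => by
    have := hstep k; omega
  have hts := tail_sum (n := d + 1) (fun k => A k - A (k + 1)) A hAd (fun t ht => by
    have := hstep ⟨t, ht⟩
    simp only at this
    simp only
    omega)
  refine Prod.ext ?_ ?_
  · rw [lead_fst]
    simp only [hN]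
    have := hts 0 (by omega)
    simpa [hA0] using this
  · funext j
    obtain ⟨i, rfl⟩ := σ.surjective j
    rw [lead_snd]
    simp only [hN]
    have := hts (i + 1) (by omega)
    rw [hA1] at this
    exact this

lemma perm_unique {d : ℕ} (g : Fin d → ℕ) (σ τ : Equiv.Perm (Fin d))
    (h1 : StrictAnti fun i => g (σ i)) (h2 : StrictAnti fun i => g (τ i))
    (hg : Function.Injective g) : σ = τ := by
  have h := Tuple.unique_antitone (f := g) (σ := σ) (τ := τ) h1.antitone h2.antitone
  ext i
  have := congrFun h i
  rw [hg this]

lemma lead_inj {d : ℕ} {σ τ : Equiv.Perm (Fin d)} {m n : Fin (d + 1) → ℕ}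
    (h : lead σ m = lead τ n) : σ = τ ∧ m = n := by
  have hσ : σ = τ := by
    refine perm_unique (key (lead σ m).2) σ τ (lead_strictAnti σ m) ?_ (key_injective _)
    rw [h]; exact lead_strictAnti τ n
  subst hσ
  refine ⟨rfl, ?_⟩
  have hall : ∀ t ≤ d, (∑ k : Fin (d + 1), if t ≤ (k : ℕ) then (m k + D σ k) else 0) =
      ∑ k : Fin (d + 1), if t ≤ (k : ℕ) then (n k + D σ k) else 0 := by
    intro t ht
    cases t with
    | zero =>
      have := congrArg Prod.fst h
      rw [lead_fst, lead_fst] at this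
      simpa using this
    | succ t =>
      have := congrFun (congrArg Prod.snd h) (σ ⟨t, ht⟩)
      rw [lead_snd, lead_snd] at this
      exact this
  have hall' : ∀ t, (∑ k : Fin (d + 1), if t ≤ (k : ℕ) then (m k + D σ k) else 0) =
      ∑ k : Fin (d + 1), if t ≤ (k : ℕ) then (n k + D σ k) else 0 := by
    intro t
    by_cases ht : t ≤ d
    · exact hall t ht
    · refine Finset.sum_congr rfl fun k _ => ?_
      rw [if_neg (by omega), if_neg (by omega)]
  funext k
  have e1 := tail_step (fun k => m k + D σ k) k k.isLt
  have e2 := tail_step (fun k => n k + D σ k) k k.isLt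
  have e3 := hall' k
  have e4 := hall' (k + 1)
  simp only [Nat.add_one_le_iff, Fin.eta] at e1 e2 e3 e4
  omega

/-- index type of the basis -/
abbrev G (d : ℕ) := Equiv.Perm (Fin d) × (Fin (d + 1) → ℕ)

/-- the basis of the toric ring -/
noncomputable def f {d : ℕ} (g : G d) : R d := phi d (F g.1 g.2)

lemma coeff_of_mem_span {d : ℕ} {X : Set (M d)} {p : R d}
    (hp : p ∈ Submodule.span ℂ (mon '' X)) {e : M d} (he : e ∉ X) : p.coeff e = 0 := by
  induction hp using Submodule.span_induction with
  | mem x hx =>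
    obtain ⟨h, hh, rfl⟩ := hx
    rw [coeff_mon, if_neg]
    rintro rfl
    exact he hh
  | zero => simp
  | add x y _ _ hx hy => simp [hx, hy]
  | smul a x _ hx => simp [hx]

lemma coeff_f {d : ℕ} (g : G d) (e : M d) (he : Phi (lead g.1 g.2).2 ≤ Phi e.2) :
    (f g).coeff e = if lead g.1 g.2 = e then 1 else 0 := by
  have h := coeff_of_mem_span (e := e) (phi_F g.1 g.2) (fun h => absurd h.1 (not_lt.2 he))
  rw [← coeff_mon]
  rw [AddMonoidAlgebra.coeff_sub, Finsupp.sub_apply, sub_eq_zero] at h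
  exact h

lemma f_linearIndependent {d : ℕ} : LinearIndependent ℂ (f : G d → R d) := by
  classical
  rw [linearIndependent_iff']
  intro s c hs
  by_contra hcon
  push Not at hcon
  obtain ⟨g1, hg1, hc1⟩ := hcon
  obtain ⟨g0, hg0, hmax⟩ := Finset.exists_max_image (s.filter fun g => c g ≠ 0)
    (fun g => Phi (lead g.1 g.2).2) ⟨g1, Finset.mem_filter.2 ⟨hg1, hc1⟩⟩
  rw [Finset.mem_filter] at hg0
  have h := congrArg (fun x => x.coeff (lead g0.1 g0.2)) hs
  simp only [AddMonoidAlgebra.coeff_sum, Finsupp.finsetSum_apply, AddMonoidAlgebra.coeff_smul,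
    Finsupp.smul_apply, AddMonoidAlgebra.coeff_zero, Finsupp.zero_apply, smul_eq_mul] at h
  rw [Finset.sum_eq_single g0] at h
  · rw [coeff_f _ _ le_rfl, if_pos rfl, mul_one] at h
    exact hg0.2 h
  · intro g hg hne
    by_cases hc : c g = 0
    · rw [hc, zero_mul]
    · rw [coeff_f _ _ (hmax g (Finset.mem_filter.2 ⟨hg, hc⟩)), if_neg, mul_zero]
      intro hl
      obtain ⟨h1, h2⟩ := lead_inj hl
      exact hne (Prod.ext h1 h2)
  · intro h'; exact absurd hg0.1 h'

lemma mon_mem_span {d : ℕ} (n : ℕ) : ∀ e : M d, Phi e.2 = n → e ∈ E d →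
    mon e ∈ Submodule.span ℂ (f '' {g : G d | bd (lead g.1 g.2) = bd e}) := by
  induction n using Nat.strong_induction_on with
  | _ n ih =>
    intro e hn he
    obtain ⟨σ, m, rfl⟩ := lead_surj e he
    have h1 : f (σ, m) ∈ Submodule.span ℂ
        (f '' {g : G d | bd (lead g.1 g.2) = bd (lead σ m)}) :=
      Submodule.subset_span ⟨(σ, m), rfl, rfl⟩
    have h2 : Submodule.span ℂ (mon '' lowerSet (lead σ m)) ≤ Submodule.span ℂ
        (f '' {g : G d | bd (lead g.1 g.2) = bd (lead σ m)}) := by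
      rw [Submodule.span_le]
      rintro _ ⟨h, ⟨hlt, hb, hE⟩, rfl⟩
      have := ih (Phi h.2) (by omega) h rfl hE
      rw [hb] at this
      exact this
    have h3 := Submodule.sub_mem _ h1 (h2 (phi_F σ m))
    have h4 : f (σ, m) - (phi d (F σ m) - mon (lead σ m)) = mon (lead σ m) := by
      simp [f]
    rw [h4] at h3
    exact h3

lemma phi_monomial {d : ℕ} (s : (Fin d → Fin 2) →₀ ℕ) :
    phi d (monomial s 1) = mon (∑ v ∈ s.support, s v • ev v) := by
  rw [phi, aeval_monomial, map_one, one_mul, mon_sum]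
  simp only [mon_nsmul]
  rfl

lemma bd_monomial {d : ℕ} (s : (Fin d → Fin 2) →₀ ℕ) :
    bd (∑ v ∈ s.support, s v • ev v) =
      ((s.sum fun _ n => n), (s.sum fun v n => n * ∑ i, (v i : ℕ))) := by
  rw [map_sum]
  simp only [map_nsmul, bd_ev]
  refine Prod.ext ?_ ?_
  · simp [Prod.fst_sum, Finsupp.sum]
  · simp [Prod.snd_sum, Finsupp.sum, vec]

lemma phi_monomial_mem {d : ℕ} (s : (Fin d → Fin 2) →₀ ℕ) :
    phi d (monomial s 1) ∈ Submodule.span ℂ (f '' {g : G d | bd (lead g.1 g.2) =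
      ((s.sum fun _ n => n), (s.sum fun v n => n * ∑ i, (v i : ℕ)))}) := by
  rw [phi_monomial, ← bd_monomial]
  exact mon_mem_span _ _ rfl (sum_mem fun _ _ => nsmul_mem (ev_mem_E _) _)

lemma phi_component {d r k : ℕ} {p : S d} (hp : p ∈ cubeComponent d r k) :
    phi d p ∈ Submodule.span ℂ (f '' {g : G d | bd (lead g.1 g.2) = (r, k)}) := by
  have : cubeComponent d r k ≤ (Submodule.span ℂ (f '' {g : G d | bd (lead g.1 g.2) =
      (r, k)})).comap (phi d).toLinearMap := by
    unfold cubeComponent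
    rw [Submodule.span_le]
    rintro _ ⟨s, rfl, rfl, rfl⟩
    exact phi_monomial_mem s
  exact this hp

lemma phi_mem_all {d : ℕ} (p : S d) : phi d p ∈ Submodule.span ℂ (Set.range (f : G d → R d)) := by
  have : (⊤ : Submodule ℂ (S d)) ≤
      (Submodule.span ℂ (Set.range (f : G d → R d))).comap (phi d).toLinearMap := by
    rw [← (basisMonomials (Fin d → Fin 2) ℂ).span_eq, Submodule.span_le]
    rintro _ ⟨s, rfl⟩
    rw [coe_basisMonomials]
    exact Submodule.span_mono (Set.image_subset_range _ _) (phi_monomial_mem s)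
  exact this trivial

/-- The ideal `J`. -/
noncomputable abbrev J (d : ℕ) : Ideal (S d) :=
  cubeIdeal d ⊔ Ideal.span ((fun j : Fin (d + 1) => cubeY d j) '' Set.univ)

lemma F_mul {d : ℕ} (σ : Equiv.Perm (Fin d)) (m : Fin (d + 1) → ℕ) (j : Fin (d + 1)) :
    F σ m * cubeY d j = F σ (m + Pi.single j 1) := by
  classical
  have : ∏ k : Fin (d + 1), cubeY d k ^ (Pi.single j 1 : Fin (d + 1) → ℕ) k = cubeY d j := by
    rw [Finset.prod_eq_single j]
    · simp
    · intro b _ hb; simp [Pi.single_eq_of_ne hb]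
    · simp
  simp only [F, Pi.add_apply, pow_add, Finset.prod_mul_distrib, this]
  ring

lemma phi_J {d : ℕ} {p : S d} (hp : p ∈ J d) :
    phi d p ∈ Submodule.span ℂ (f '' {g : G d | g.2 ≠ 0}) := by
  obtain ⟨a, ha, b, hb, rfl⟩ := Submodule.mem_sup.1 hp
  rw [map_add, cubeIdeal_le_ker ha, zero_add]
  clear hp ha
  suffices h : ∀ c : S d, phi d (c * b) ∈ Submodule.span ℂ (f '' {g : G d | g.2 ≠ 0}) by
    simpa using h 1
  induction hb using Submodule.span_induction with
  | mem x hx =>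
    obtain ⟨j, -, rfl⟩ := hx
    intro c
    have : Submodule.span ℂ (Set.range (f : G d → R d)) ≤
        (Submodule.span ℂ (f '' {g : G d | g.2 ≠ 0})).comap
          (LinearMap.mulRight ℂ (phi d (cubeY d j))) := by
      rw [Submodule.span_le]
      rintro _ ⟨g, rfl⟩
      apply Submodule.subset_span
      refine ⟨(g.1, g.2 + Pi.single j 1), ?_, ?_⟩
      · intro h
        have := congrFun h j
        simp at this
      · simp only [f, LinearMap.mulRight_apply, ← map_mul, F_mul]
    have h := this (phi_mem_all c)
    rw [map_mul]
    exact h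
  | zero => intro c; simp
  | add x y _ _ hx hy => intro c; rw [mul_add, map_add]; exact add_mem (hx c) (hy c)
  | smul a x _ hx => intro c; rw [smul_eq_mul, ← mul_assoc]; exact hx _

lemma cubeY_mem_J {d : ℕ} (j : Fin (d + 1)) : cubeY d j ∈ J d :=
  Ideal.mem_sup_right (Ideal.subset_span ⟨j, trivial, rfl⟩)

lemma F_mem_J {d : ℕ} (σ : Equiv.Perm (Fin d)) (m : Fin (d + 1) → ℕ) (hm : m ≠ 0) :
    F σ m ∈ J d := by
  obtain ⟨k, hk⟩ := Function.ne_iff.1 hm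
  refine Ideal.mul_mem_left _ _ (Ideal.mem_of_dvd _ ?_ (cubeY_mem_J k))
  exact (dvd_pow_self _ hk).trans (Finset.dvd_prod_of_mem _ (Finset.mem_univ k))

lemma sum_D {d : ℕ} (σ : Equiv.Perm (Fin d)) (g : ℕ → ℕ) :
    ∑ k : Fin (d + 1), D σ k * g k = ∑ i ∈ descentSet σ, g ((i : ℕ) + 1) := by
  classical
  rw [Fin.sum_univ_succ]
  simp only [D_succ]
  have : D σ 0 = 0 := rfl
  rw [this]
  simp only [Fin.val_succ, ite_mul, zero_mul, one_mul, zero_add]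
  rw [← Finset.sum_filter]
  congr 1
  ext i; simp

lemma bd_cexp {d : ℕ} (σ : Equiv.Perm (Fin d)) : bd (cexp σ) = (desc σ, maj σ) := by
  rw [cexp, map_sum]
  have h : ∀ k : Fin (d + 1), bd (D σ k • ev (topV σ k)) = (D σ k * 1, D σ k * k) := by
    intro k
    rw [map_nsmul, bd_ev, sum_vec_topV σ (by omega)]
    rfl
  simp only [h]
  refine Prod.ext ?_ ?_
  · rw [Prod.fst_sum]
    simp only
    rw [sum_D σ (fun _ => 1)]
    simp [desc]
  · rw [Prod.snd_sum]
    simp only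
    rw [sum_D σ (fun k => k)]
    rfl

lemma F_zero {d : ℕ} (σ : Equiv.Perm (Fin d)) :
    F σ 0 = monomial (∑ k : Fin (d + 1), Finsupp.single (topV σ k) (D σ k)) 1 := by
  have h : F σ 0 = ∏ k : Fin (d + 1), X (topV σ k) ^ (D σ k) := by simp [F]
  rw [h]
  simp only [X_pow_eq_monomial]
  exact (monomial_sum_one _ _).symm

lemma phi_F_zero {d : ℕ} (σ : Equiv.Perm (Fin d)) : phi d (F σ 0) = mon (cexp σ) := by
  rw [cexp, mon_sum]
  simp only [mon_nsmul]
  simp [F, phi_X]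

lemma F_zero_mem {d : ℕ} (σ : Equiv.Perm (Fin d)) :
    F σ 0 ∈ cubeComponent d (desc σ) (maj σ) := by
  have h1 := phi_F_zero σ
  rw [F_zero, phi_monomial] at h1
  have h2 := congrArg bd (mon_injective h1)
  rw [bd_monomial, bd_cexp] at h2
  apply Submodule.subset_span
  exact ⟨_, congrArg Prod.fst h2, congrArg Prod.snd h2, F_zero σ⟩

lemma component_le {d r k : ℕ} {p : S d} (hp : p ∈ cubeComponent d r k) :
    ∃ q ∈ Submodule.span ℂ (Set.range
      (fun σ : {σ : Equiv.Perm (Fin d) // desc σ = r ∧ maj σ = k} => F σ.1 0)),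
      p - q ∈ J d := by
  have h1 := phi_component hp
  have h2 : f '' {g : G d | bd (lead g.1 g.2) = (r, k)} =
      (phi d).toLinearMap '' ((fun g : G d => F g.1 g.2) '' {g : G d | bd (lead g.1 g.2) = (r, k)})
      := by
    rw [Set.image_image]; rfl
  rw [h2, Submodule.span_image] at h1
  obtain ⟨q', hq', hpq⟩ := h1
  have h3 : p - q' ∈ J d := by
    apply Ideal.mem_sup_left
    apply ker_le_cubeIdeal
    rw [map_sub, sub_eq_zero]
    exact hpq.symm
  have h4 : Submodule.span ℂ ((fun g : G d => F g.1 g.2) '' {g : G d | bd (lead g.1 g.2) = (r, k)})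
      ≤ Submodule.span ℂ (Set.range
      (fun σ : {σ : Equiv.Perm (Fin d) // desc σ = r ∧ maj σ = k} => F σ.1 0)) ⊔
        (J d).restrictScalars ℂ := by
    rw [Submodule.span_le]
    rintro _ ⟨⟨σ, m⟩, hg, rfl⟩
    by_cases hm : m = 0
    · subst hm
      apply Submodule.mem_sup_left
      apply Submodule.subset_span
      have hg' : bd (lead σ 0) = (r, k) := hg
      rw [← cexp_eq, bd_cexp] at hg'
      exact ⟨⟨σ, congrArg Prod.fst hg', congrArg Prod.snd hg'⟩, rfl⟩
    · exact Submodule.mem_sup_right (F_mem_J σ m hm)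
  obtain ⟨q, hq, j, hj, rfl⟩ := Submodule.mem_sup.1 (h4 hq')
  refine ⟨q, hq, ?_⟩
  have : p - q = (p - (q + j)) + j := by ring
  rw [this]
  exact add_mem h3 hj


end CubeT

open scoped Classical in
/-- The bigraded Hilbert series of `T_{C_d} = S/(I_{C_d} + (y_0,…,y_d))` is the refined
Eulerian polynomial: for every `(r,k)`, the `ℂ`-dimension of
`S_{(r,k)}/(S_{(r,k)} ∩ J)` (where `J = I_{C_d} + (y_0,…,y_d)`) equals the number of
permutations `σ ∈ S_d` with `desc σ = r` and `maj σ = k`. -/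
theorem cubeT_hilbert_series (d : ℕ) (hd : 1 ≤ d) (r k : ℕ) :
    Module.finrank ℂ
      (cubeComponent d r k ⧸
        (Submodule.comap (cubeComponent d r k).subtype
          ((Submodule.restrictScalars ℂ
              (cubeIdeal d ⊔ Ideal.span ((fun j : Fin (d + 1) => cubeY d j) '' Set.univ))) ⊓
            cubeComponent d r k))) =
    (Finset.univ.filter fun σ : Equiv.Perm (Fin d) => desc σ = r ∧ maj σ = k).card := by
  classical
  set C := cubeComponent d r k with hC
  let I := {σ : Equiv.Perm (Fin d) // desc σ = r ∧ maj σ = k}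
  have hmem : ∀ σ : I, CubeT.F σ.1 0 ∈ C := by
    rintro ⟨σ, rfl, rfl⟩
    exact CubeT.F_zero_mem σ
  let N := Submodule.comap C.subtype ((Submodule.restrictScalars ℂ (CubeT.J d)) ⊓ C)
  let b : I → C ⧸ N := fun σ => Submodule.Quotient.mk ⟨CubeT.F σ.1 0, hmem σ⟩
  have hmk : ∀ x : C, (Submodule.Quotient.mk x : C ⧸ N) = 0 ↔ (x : CubeT.S d) ∈ CubeT.J d := by
    intro x
    rw [Submodule.Quotient.mk_eq_zero]
    constructor
    · intro h; exact h.1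
    · intro h; exact ⟨h, x.2⟩
  have hli : LinearIndependent ℂ b := by
    rw [Fintype.linearIndependent_iff]
    intro c hc
    have h1 : ∑ σ, c σ • b σ = Submodule.Quotient.mk
        (∑ σ, c σ • (⟨CubeT.F σ.1 0, hmem σ⟩ : C)) := by
      change _ = N.mkQ _
      rw [map_sum]
      simp only [map_smul]
      rfl
    rw [h1, hmk] at hc
    have h2 := CubeT.phi_J hc
    simp only [AddSubmonoidClass.coe_finsetSum, SetLike.val_smul, map_sum, map_smul] at h2
    have hf0 : LinearIndependent ℂ (fun σ : I => CubeT.f (σ.1, 0)) :=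
      CubeT.f_linearIndependent.comp (fun σ : I => ((σ.1, 0) : CubeT.G d)) (by
        intro x y h
        exact Subtype.ext (congrArg Prod.fst h))
    have h3 : ∑ σ : I, c σ • CubeT.f (σ.1, 0) ∈
        Submodule.span ℂ (CubeT.f '' {g : CubeT.G d | g.2 = 0}) :=
      Submodule.sum_mem _ fun σ _ => Submodule.smul_mem _ _
        (Submodule.subset_span ⟨(σ.1, 0), rfl, rfl⟩)
    have h4 := (CubeT.f_linearIndependent (d := d)).disjoint_span_image
      (s := {g : CubeT.G d | g.2 = 0}) (t := {g : CubeT.G d | g.2 ≠ 0}) (by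
        rw [Set.disjoint_left]
        intro g h h'
        exact h' h)
    have h5 := Submodule.disjoint_def.1 h4 _ h3 h2
    exact Fintype.linearIndependent_iff.1 hf0 c h5
  have hspan : ⊤ ≤ Submodule.span ℂ (Set.range b) := by
    rintro x -
    obtain ⟨⟨p, hp⟩, rfl⟩ := Submodule.Quotient.mk_surjective _ x
    obtain ⟨q, hq, hpq⟩ := CubeT.component_le hp
    have hle : Submodule.span ℂ (Set.range (fun σ : I => CubeT.F σ.1 0)) ≤
        (Submodule.comap N.mkQ (Submodule.span ℂ (Set.range b))).map C.subtype := by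
      rw [Submodule.span_le]
      rintro _ ⟨σ, rfl⟩
      exact ⟨⟨_, hmem σ⟩, Submodule.subset_span ⟨σ, rfl⟩, rfl⟩
    obtain ⟨q', hq', hqq⟩ := hle hq
    have h6 : (Submodule.Quotient.mk (⟨p, hp⟩ : C) : C ⧸ N) = Submodule.Quotient.mk q' := by
      rw [← sub_eq_zero, ← Submodule.Quotient.mk_sub, hmk]
      have : ((⟨p, hp⟩ - q' : C) : CubeT.S d) = p - q := by
        rw [← hqq]; rfl
      rw [this]
      exact hpq
    rw [h6]
    exact hq'
  have hfin := Module.finrank_eq_card_basis (Module.Basis.mk hli hspan)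
  have hcard : Fintype.card I =
      (Finset.univ.filter fun σ : Equiv.Perm (Fin d) => desc σ = r ∧ maj σ = k).card := by
    rw [Fintype.card_subtype]
  rw [← hcard, ← hfin]
end
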